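/- For odd degree d = 2k−1, the algebraic boundary of the region of real binary forms of typical rank d (maximal rank) equals the dual variety (Δ_{(d)})^∨ of the rational normal curve, i.e., the discriminant hypersurface of degree-d binary forms; moreover the open region R_{d,d} consists exactly of the forms with d distinct real roots. -/

import Mathlib

open MvPolynomial

noncomputable section

/-- The Zariski closure of a subset of the affine space `σ → K`. -/
def zClosure {K : Type} [Field K] {σ : Type} [Fintype σ] [DecidableEq σ]
    (S : Set (σ → K)) : Set (σ → K) :=
  {x | ∀ p : MvPolynomial σ K, (∀ y ∈ S, eval y p = 0) → eval x p = 0}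

/-- A subset of affine space is Zariski closed if it equals its Zariski closure. -/
def zClosed {K : Type} [Field K] {σ : Type} [Fintype σ] [DecidableEq σ]
    (S : Set (σ → K)) : Prop :=
  zClosure S = S

/-- Irreducibility of a subset of affine space in the Zariski topology,
tested against the basic open sets. -/
def zIrreducible {K : Type} [Field K] {σ : Type} [Fintype σ] [DecidableEq σ]
    (S : Set (σ → K)) : Prop :=
  S.Nonempty ∧ ∀ p q : MvPolynomial σ K,
    (∀ x ∈ S, eval x p = 0 ∨ eval x q = 0) →
    (∀ x ∈ S, eval x p = 0) ∨ (∀ x ∈ S, eval x q = 0)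

/-- There is a strictly increasing chain of `m+1` irreducible Zariski-closed
subsets contained in `S`. -/
def zChain {K : Type} [Field K] {σ : Type} [Fintype σ] [DecidableEq σ]
    (S : Set (σ → K)) (m : ℕ) : Prop :=
  ∃ c : Fin (m+1) → Set (σ → K),
    (∀ i, zIrreducible (c i) ∧ zClosed (c i) ∧ c i ⊆ S) ∧
    ∀ i j : Fin (m+1), i < j → c i ⊂ c j

/-- `S` has (Krull) dimension `m` in the Zariski topology. -/
def zDimEq {K : Type} [Field K] {σ : Type} [Fintype σ] [DecidableEq σ]
    (S : Set (σ → K)) (m : ℕ) : Prop :=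
  zChain S m ∧ ¬ zChain S (m+1)

/-- The (embedded, affine) Zariski tangent space to `S` at `a`: the common kernel of the
differentials at `a` of all polynomials vanishing on `S`. -/
def zTangentAt {K : Type} [Field K] {σ : Type} [Fintype σ] [DecidableEq σ]
    (S : Set (σ → K)) (a : σ → K) : Set (σ → K) :=
  {v | ∀ p : MvPolynomial σ K, (∀ y ∈ S, eval y p = 0) →
        ∑ i : σ, eval a (pderiv i p) * v i = 0}

/-- Dimension of the Zariski tangent space at a point. -/
def zTangentDim {K : Type} [Field K] {σ : Type} [Fintype σ] [DecidableEq σ]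
    (S : Set (σ → K)) (a : σ → K) : ℕ :=
  Module.finrank K (Submodule.span K (zTangentAt S a))

/-- The binary form of degree `r` with coefficient vector `a`. -/
def binForm {K : Type} [CommSemiring K] (r : ℕ) (a : Fin (r+1) → K) :
    MvPolynomial (Fin 2) K :=
  ∑ i : Fin (r+1), C (a i) * X 0 ^ (r - (i : ℕ)) * X 1 ^ (i : ℕ)

/-- The linear binary form `u·x + v·y`. -/
def linForm {K : Type} [CommSemiring K] (u v : K) : MvPolynomial (Fin 2) K :=
  C u * X 0 + C v * X 1

/-- The affine cone over the coincident root locus `Δ_λ ⊆ ℙ^r`, in coefficient coordinates: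
scalar multiples of forms `∏ ℓ_i ^ λ_i`. -/
def crlCone (r n : ℕ) (lam : Fin n → ℕ) : Set (Fin (r+1) → ℂ) :=
  {a | ∃ (t : ℂ) (u v : Fin n → ℂ),
    binForm r a = C t * ∏ i, (linForm (u i) (v i)) ^ lam i}

/-- `lam` is a partition of `r` of length `n` (all parts positive). -/
def isPartitionOf (r n : ℕ) (lam : Fin n → ℕ) : Prop :=
  (∀ i, 1 ≤ lam i) ∧ ∑ i, lam i = r

/-- The multiplicity `m_j` of the part `j` in the partition `lam`. -/
def multOf {n : ℕ} (lam : Fin n → ℕ) (jj : ℕ) : ℕ :=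
  (Finset.univ.filter fun i => lam i = jj).card

/-- The differential operator of degree `s` with coefficient vector `b`, i.e.
`∑ b_i ∂x^(s-i) ∂y^i`, applied to `f`. -/
def diffOp {K : Type} [CommSemiring K] (s : ℕ) (b : Fin (s+1) → K)
    (f : MvPolynomial (Fin 2) K) : MvPolynomial (Fin 2) K :=
  ∑ i : Fin (s+1), b i •
    ((fun g => pderiv (0 : Fin 2) g)^[s - (i : ℕ)]
      (((fun g => pderiv (1 : Fin 2) g)^[(i : ℕ)]) f))

/-- The apolarity pairing between a degree-`d` operator (coefficients `h`) and a
degree-`d` form (coefficients `a`). -/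
def apolarPair (d : ℕ) (h a : Fin (d+1) → ℂ) : ℂ :=
  eval (fun _ => (0 : ℂ)) (diffOp d h (binForm d a))

/-- The cone over the dual variety of the cone `S ⊆ ℂ^(m+1)` (with `k` the dimension of the
cone `S`, used to select smooth points): closure of the set of hyperplanes, written in dual
coordinates via the apolarity pairing, containing an embedded tangent space at a smooth point. -/
def dualConeOf (m : ℕ) (S : Set (Fin (m+1) → ℂ)) (k : ℕ) : Set (Fin (m+1) → ℂ) :=
  zClosure {h | h ≠ 0 ∧ ∃ a ∈ S, a ≠ 0 ∧ zTangentDim S a = k ∧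
      ∀ v ∈ zTangentAt S a, apolarPair m h v = 0}

/-- The row span of a matrix, as a subspace of `ℂ^m`. -/
def rowSpan {k m : ℕ} (M : Matrix (Fin k) (Fin m) ℂ) : Submodule ℂ (Fin m → ℂ) :=
  Submodule.span ℂ (Set.range fun i => M i)

/-- The (redundant) Plücker coordinate vector of the row span of `M`: all maximal minors. -/
def plucker {k m : ℕ} (M : Matrix (Fin k) (Fin m) ℂ) : (Fin k → Fin m) → ℂ :=
  fun s => (M.submatrix id s).det

/-- The degree-`s` component of the apolar ideal of the degree-`d` form with
coefficients `a`, as a subset of the coefficient space of operators. -/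
def apolarSet (d s : ℕ) (a : Fin (d+1) → ℂ) : Set (Fin (s+1) → ℂ) :=
  {b | diffOp s b (binForm d a) = 0}

/-- The (pre-closure) cone, in Plücker coordinates, over the `j`-th higher associated variety
`CH_j(S)`: spans of `k`-row matrices whose row space contains a smooth point `x` of the cone
`S` (`dimS` = dimension of the cone `S`) and meets the tangent space at `x` in projective
dimension at least `j`. -/
def smoothCHCone (m : ℕ) (S : Set (Fin (m+1) → ℂ)) (dimS k j : ℕ) :
    Set ((Fin k → Fin (m+1)) → ℂ) :=
  {u | ∃ M : Matrix (Fin k) (Fin (m+1)) ℂ, u = plucker M ∧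
    Module.finrank ℂ (rowSpan M) = k ∧
    ∃ x, x ≠ 0 ∧ x ∈ S ∧ zTangentDim S x = dimS ∧ x ∈ rowSpan M ∧
      j + 1 ≤ Module.finrank ℂ ↥(rowSpan M ⊓ Submodule.span ℂ (zTangentAt S x))}

/-- The (pre-closure) cone, in Plücker coordinates, over `Ξ_0(S)`: spans of `k`-row matrices
whose row space meets the cone `S` nontrivially. -/
def meetCone (m : ℕ) (S : Set (Fin (m+1) → ℂ)) (k : ℕ) :
    Set ((Fin k → Fin (m+1)) → ℂ) :=
  {u | ∃ M : Matrix (Fin k) (Fin (m+1)) ℂ, u = plucker M ∧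
    Module.finrank ℂ (rowSpan M) = k ∧ ∃ x, x ≠ 0 ∧ x ∈ S ∧ x ∈ rowSpan M}

/-- The preimage under the apolar map `Ψ_{d,s}` of a subset `T` of the Grassmannian
(in Plücker coordinates) of `(k-1)`-projective-dimensional subspaces of `ℙ(D_s)`. -/
def apolarPull (d s k : ℕ) (T : Set ((Fin k → Fin (s+1)) → ℂ)) : Set (Fin (d+1) → ℂ) :=
  {a | ∃ M : Matrix (Fin k) (Fin (s+1)) ℂ,
    rowSpan M = Submodule.span ℂ (apolarSet d s a) ∧
    Module.finrank ℂ (rowSpan M) = k ∧ plucker M ∈ T}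

/-- The Waring rank over `K` of a binary form: the least `r` such that `f` is a sum of `r`
scalar multiples of `d`-th powers of linear forms. -/
def waringRank {K : Type} [Field K] (d : ℕ) (f : MvPolynomial (Fin 2) K) : ℕ :=
  sInf {r | ∃ (α u v : Fin r → K), f = ∑ i, α i • (linForm (u i) (v i)) ^ d}

/-- The set of coefficient vectors of real binary forms of degree `d` of real rank `r`. -/
def realRankSet (d r : ℕ) : Set (Fin (d+1) → ℝ) :=
  {a | waringRank d (binForm d a) = r}

/-- `R_{d,r}`: the interior, in the Euclidean topology, of the set of real binary forms of
degree `d` and real rank `r`. -/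
def Rdr (d r : ℕ) : Set (Fin (d+1) → ℝ) := interior (realRankSet d r)

/-- The topological boundary of `R_{d,r}`: the closure of `R_{d,r}` minus the interior of
the closure. -/
def topBoundary (d r : ℕ) : Set (Fin (d+1) → ℝ) :=
  closure (Rdr d r) \ interior (closure (Rdr d r))

/-- The algebraic boundary `∂_alg(R_{d,r})`: the Zariski closure over `ℂ` of the topological
boundary of `R_{d,r}`. -/
def algBoundary (d r : ℕ) : Set (Fin (d+1) → ℂ) :=
  zClosure ((fun a i => ((a i : ℝ) : ℂ)) '' topBoundary d r)


/-- Value of the binary form with coefficients `a` at `(x,y)`. -/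
def fe {K : Type} [CommSemiring K] (d : ℕ) (a : Fin (d+1) → K) (x y : K) : K :=
  ∑ i : Fin (d+1), a i * x ^ (d - (i : ℕ)) * y ^ (i : ℕ)

lemma eval_binForm {K : Type} [CommSemiring K] (d : ℕ) (a : Fin (d+1) → K) (x y : K) :
    eval ![x, y] (binForm d a) = fe d a x y := by
  simp [binForm, fe]

lemma eval_linForm {K : Type} [CommSemiring K] (u v x y : K) :
    eval ![x, y] (linForm u v) = u * x + v * y := by
  simp [linForm]

lemma binForm_inj {K : Type} [CommSemiring K] (d : ℕ) {a b : Fin (d+1) → K}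
    (h : binForm d a = binForm d b) : a = b := by
  have key : ∀ a : Fin (d+1) → K, ∀ j : Fin (d+1),
      (eval₂ (Polynomial.C) ![(1 : Polynomial K), Polynomial.X] (binForm d a)).coeff j = a j := by
    intro a j
    simp [binForm, eval₂_sum, eval₂_mul, eval₂_pow]
    rw [Finset.sum_eq_single j]
    · simp
    · intro b _ hb
      rw [if_neg]
      intro h; exact hb (Fin.ext h.symm)
    · simp
  funext j
  rw [← key a j, h, key b j]

lemma binForm_add {K : Type} [CommSemiring K] (d : ℕ) (a b : Fin (d+1) → K) :
    binForm d (a + b) = binForm d a + binForm d b := by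
  simp [binForm, add_mul, Finset.sum_add_distrib]

lemma binForm_smul {K : Type} [CommSemiring K] (d : ℕ) (t : K) (a : Fin (d+1) → K) :
    binForm d (t • a) = C t * binForm d a := by
  simp [binForm, Finset.mul_sum, mul_assoc]

lemma binForm_zero {K : Type} [CommSemiring K] (d : ℕ) :
    binForm d (0 : Fin (d+1) → K) = 0 := by
  simp [binForm]

lemma binForm_eq_zero {K : Type} [CommSemiring K] (d : ℕ) {a : Fin (d+1) → K}
    (h : binForm d a = 0) : a = 0 :=
  binForm_inj d (h.trans (binForm_zero d).symm)

/-- Coefficients of `(u x + v y) * binForm n b`. -/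
def mulLin {K : Type} [CommSemiring K] (n : ℕ) (u v : K) (b : Fin (n+1) → K) : Fin (n+2) → K :=
  fun i => u * (Fin.snoc b 0 : Fin (n+2) → K) i + v * (Fin.cons 0 b : Fin (n+2) → K) i

lemma binForm_mulLin {K : Type} [CommSemiring K] (n : ℕ) (u v : K) (b : Fin (n+1) → K) :
    binForm (n+1) (mulLin n u v b) = linForm u v * binForm n b := by
  have h1 : binForm (n+1) (Fin.snoc b 0 : Fin (n+2) → K) = X 0 * binForm n b := by
    unfold binForm
    rw [Fin.sum_univ_castSucc]
    simp [Finset.mul_sum]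
    refine Finset.sum_congr rfl fun i _ => ?_
    have : n + 1 - (i : ℕ) = (n - i) + 1 := by have := i.2; omega
    rw [this, pow_succ]; ring
  have h2 : binForm (n+1) (Fin.cons 0 b : Fin (n+2) → K) = X 1 * binForm n b := by
    unfold binForm
    rw [Fin.sum_univ_succ]
    simp [Finset.mul_sum]
    refine Finset.sum_congr rfl fun i _ => ?_
    rw [pow_succ]; ring
  have h3 : mulLin n u v b = u • (Fin.snoc b 0 : Fin (n+2) → K) + v • (Fin.cons 0 b : Fin (n+2) → K) := by
    funext i; simp [mulLin]
  rw [h3, binForm_add, binForm_smul, binForm_smul, h1, h2, linForm]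
  ring

lemma prod_linForm {K : Type} [CommSemiring K] (n : ℕ) (A B : Fin n → K) :
    ∃ b : Fin (n+1) → K, ∏ i, linForm (A i) (B i) = binForm n b := by
  induction n with
  | zero => exact ⟨fun _ => 1, by simp [binForm]⟩
  | succ n ih =>
    obtain ⟨b, hb⟩ := ih (fun i => A i.succ) (fun i => B i.succ)
    refine ⟨mulLin n (A 0) (B 0) b, ?_⟩
    rw [Fin.prod_univ_succ, hb, binForm_mulLin]

lemma linForm_ne_zero {K : Type} [Field K] {u v : K} (h : u ≠ 0 ∨ v ≠ 0) : linForm u v ≠ 0 := by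
  intro h0
  have h1 := eval_linForm u v 1 0
  have h2 := eval_linForm u v 0 1
  rw [h0] at h1 h2
  simp at h1 h2
  rcases h with h | h
  · exact h h1.symm
  · exact h h2.symm

lemma linForm_eq_zero {K : Type} [Field K] : linForm (0:K) 0 = 0 := by simp [linForm]

/-- evaluation as a linear functional -/
def feL {K : Type} [Field K] (d : ℕ) (x y : K) : (Fin (d+1) → K) →ₗ[K] K where
  toFun a := fe d a x y
  map_add' a b := by simp [fe, add_mul, Finset.sum_add_distrib]
  map_smul' t a := by simp [fe, Finset.mul_sum, mul_assoc]

lemma fe_single_zero {K : Type} [Field K] (d : ℕ) (x y : K) :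
    fe d (Pi.single 0 1) x y = x ^ d := by
  unfold fe
  rw [Finset.sum_eq_single 0] <;> simp +contextual

lemma fe_single_last {K : Type} [Field K] (d : ℕ) (x y : K) :
    fe d (Pi.single (Fin.last d) 1) x y = y ^ d := by
  unfold fe
  rw [Finset.sum_eq_single (Fin.last d)] <;> simp +contextual

lemma div_linForm {K : Type} [Field K] (n : ℕ) (a : Fin (n+2) → K) (x y : K)
    (h0 : x ≠ 0 ∨ y ≠ 0) (h : fe (n+1) a x y = 0) :
    ∃ b : Fin (n+1) → K, binForm (n+1) a = linForm y (-x) * binForm n b := by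
  let T : (Fin (n+1) → K) →ₗ[K] (Fin (n+2) → K) :=
    { toFun := mulLin n y (-x)
      map_add' := fun a b => binForm_inj (n+1) (by
        rw [binForm_add, binForm_mulLin, binForm_mulLin, binForm_mulLin, binForm_add, mul_add])
      map_smul' := fun t a => binForm_inj (n+1) (by
        rw [RingHom.id_apply, binForm_smul, binForm_mulLin, binForm_mulLin, binForm_smul]; ring) }
  have hl : linForm y (-x) ≠ 0 := linForm_ne_zero (by rcases h0 with h | h <;> simp [h])
  have hT : Function.Injective T := by
    intro b c hbc
    have h1 : binForm (n+1) (mulLin n y (-x) b) = binForm (n+1) (mulLin n y (-x) c) :=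
      congrArg (binForm (n+1)) hbc
    rw [binForm_mulLin, binForm_mulLin] at h1
    exact binForm_inj n (mul_left_cancel₀ hl h1)
  have hle : LinearMap.range T ≤ LinearMap.ker (feL (n+1) x y) := by
    rintro _ ⟨b, rfl⟩
    change fe (n+1) (mulLin n y (-x) b) x y = 0
    rw [← eval_binForm, binForm_mulLin, map_mul, eval_linForm]
    ring
  have hsurj : Function.Surjective (feL (n+1) x y) := by
    apply LinearMap.surjective
    intro h1
    have h2 := LinearMap.congr_fun h1 (Pi.single 0 1)
    have h3 := LinearMap.congr_fun h1 (Pi.single (Fin.last _) 1)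
    change fe _ _ _ _ = 0 at h2
    change fe _ _ _ _ = 0 at h3
    rw [fe_single_zero] at h2
    rw [fe_single_last] at h3
    have := eq_zero_of_pow_eq_zero h2
    have := eq_zero_of_pow_eq_zero h3
    tauto
  have hr := LinearMap.finrank_range_add_finrank_ker (feL (n+1) x y)
  rw [LinearMap.range_eq_top.2 hsurj] at hr
  have hr2 := LinearMap.finrank_range_of_inj hT
  have : LinearMap.range T = LinearMap.ker (feL (n+1) x y) := by
    apply Submodule.eq_of_le_of_finrank_eq hle
    rw [finrank_top, Module.finrank_self, Module.finrank_fin_fun] at hr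
    rw [Module.finrank_fin_fun] at hr2
    linarith
  have ha : a ∈ LinearMap.range T := by rw [this]; exact h
  obtain ⟨b, rfl⟩ := ha
  exact ⟨b, binForm_mulLin _ _ _ _⟩

/-- A form with `d` pairwise non-proportional zeros is a product of linear forms. -/
lemma factor_of_zeros {K : Type} [Field K] (d : ℕ) (a : Fin (d+1) → K) (x y : Fin d → K)
    (h0 : ∀ i, x i ≠ 0 ∨ y i ≠ 0) (hi : ∀ i j, i ≠ j → x i * y j ≠ x j * y i)
    (hz : ∀ i, fe d a (x i) (y i) = 0) :
    ∃ t : K, binForm d a = C t * ∏ i, linForm (y i) (-x i) := by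
  induction d with
  | zero => exact ⟨a 0, by simp [binForm]⟩
  | succ n ih =>
    obtain ⟨b, hb⟩ := div_linForm n a (x 0) (y 0) (h0 0) (hz 0)
    obtain ⟨t, ht⟩ := ih b (fun i => x i.succ) (fun i => y i.succ) (fun i => h0 _)
      (fun i j hij => hi _ _ (by simpa using hij)) (by
        intro i
        have h1 := hz i.succ
        rw [← eval_binForm, hb, map_mul, eval_linForm, eval_binForm] at h1
        refine (mul_eq_zero.1 h1).resolve_left ?_
        intro h2
        apply hi 0 i.succ (Fin.succ_ne_zero i).symm
        linear_combination -h2)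
    refine ⟨t, ?_⟩
    rw [hb, ht, Fin.prod_univ_succ]; ring

lemma factor_complex (d : ℕ) (a : Fin (d+1) → ℂ) :
    ∃ (t : ℂ) (A B : Fin d → ℂ), binForm d a = C t * ∏ i, linForm (A i) (B i) := by
  induction d with
  | zero => exact ⟨a 0, 0, 0, by simp [binForm]⟩
  | succ n ih =>
    have : ∃ x y : ℂ, (x ≠ 0 ∨ y ≠ 0) ∧ fe (n+1) a x y = 0 := by
      by_cases hl : a (Fin.last _) = 0
      · refine ⟨0, 1, by simp, ?_⟩
        unfold fe
        rw [Fin.sum_univ_castSucc]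
        simp [hl]
        refine Finset.sum_eq_zero fun i _ => ?_
        rw [zero_pow (by have := i.2; omega)]; simp
      · let p : Polynomial ℂ := ∑ i : Fin (n+2), Polynomial.C (a i) * Polynomial.X ^ (i:ℕ)
        have hc : p.coeff (n+1) = a (Fin.last _) := by
          simp only [p, Polynomial.finsetSum_coeff, Polynomial.coeff_C_mul, Polynomial.coeff_X_pow]
          rw [Finset.sum_eq_single (Fin.last _)]
          · simp
          · intro b _ hb
            rw [if_neg]; · simp
            intro h; exact hb (Fin.ext h.symm)
          · simp
        have hd : p.degree ≠ 0 := by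
          intro h
          have := Polynomial.eq_C_of_degree_le_zero h.le
          rw [this] at hc
          simp at hc
          exact hl hc.symm
        obtain ⟨z, hz⟩ := IsAlgClosed.exists_root p hd
        refine ⟨1, z, by simp, ?_⟩
        rw [Polynomial.IsRoot, Polynomial.eval_finsetSum] at hz
        simpa [fe] using hz
    obtain ⟨x, y, h0, hz⟩ := this
    obtain ⟨b, hb⟩ := div_linForm n a x y h0 hz
    obtain ⟨t, A, B, h⟩ := ih b
    refine ⟨t, Fin.cons y A, Fin.cons (-x) B, ?_⟩
    rw [hb, h, Fin.prod_univ_succ]; simp; ring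

lemma rolle_finset (p : Polynomial ℝ) (S : Finset ℝ) (h : ∀ s ∈ S, p.eval s = 0) :
    ∃ S' : Finset ℝ, (∀ s ∈ S', p.derivative.eval s = 0) ∧ S.card ≤ S'.card + 1 := by
  by_cases hp : p.derivative = 0
  · exact ⟨S, by simp [hp], by omega⟩
  · have hp0 : p ≠ 0 := by rintro rfl; simp at hp
    refine ⟨p.derivative.roots.toFinset, ?_, ?_⟩
    · intro s hs
      simpa [hp] using hs
    · refine le_trans (Finset.card_le_card ?_) (Polynomial.card_roots_toFinset_le_derivative p)
      intro s hs
      simpa [hp0] using h s hs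

lemma exists_inj_of_card {n : ℕ} (S : Finset ℝ) (h : n ≤ S.card) :
    ∃ f : Fin n → ℝ, Function.Injective f ∧ ∀ i, f i ∈ S := by
  obtain ⟨T, hT, hc⟩ := Finset.exists_subset_card_eq h
  exact ⟨T.orderEmbOfFin hc, (T.orderEmbOfFin hc).injective, fun i => hT (T.orderEmbOfFin_mem hc i)⟩

lemma powsum_zero (r : ℕ) : ∀ d, r < d → ∀ (α u v : Fin r → ℝ) (x y : Fin d → ℝ),
    (∀ i, x i ≠ 0 ∨ y i ≠ 0) → (∀ i j, i ≠ j → x i * y j ≠ x j * y i) →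
    (∀ i, ∑ j, α j * (u j * x i + v j * y i) ^ d = 0) →
    ∀ X Y, ∑ j, α j * (u j * X + v j * Y) ^ d = 0 := by
  induction r with
  | zero => intros; simp
  | succ r ih =>
    intro d hd α u v x y h0 hi hz
    by_cases hl : u 0 = 0 ∧ v 0 = 0
    · have hs : ∀ X Y, ∑ j, α j * (u j * X + v j * Y) ^ d =
          ∑ j : Fin r, α j.succ * (u j.succ * X + v j.succ * Y) ^ d := by
        intro X Y
        rw [Fin.sum_univ_succ, hl.1, hl.2]
        simp [show d ≠ 0 by omega]
      intro X Y
      rw [hs]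
      refine ih d (by omega) _ _ _ x y h0 hi ?_ X Y
      intro i
      rw [← hs]; exact hz i
    obtain ⟨e, rfl⟩ : ∃ e, d = e + 1 := ⟨d - 1, by omega⟩
    set U := u 0 with hU
    set V := v 0 with hV
    have hN : 0 < U ^ 2 + V ^ 2 := by
      by_contra hcon
      apply hl
      constructor <;> nlinarith [sq_nonneg U, sq_nonneg V]
    set N := U ^ 2 + V ^ 2 with hNdef
    -- the function and its restriction to the line
    set F : ℝ → ℝ → ℝ := fun X Y => ∑ j, α j * (u j * X + v j * Y) ^ (e+1) with hF
    set G : ℝ → ℝ → ℝ := fun X Y => ∑ j : Fin r, (α j.succ * (u j.succ * V - v j.succ * U)) *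
      (u j.succ * X + v j.succ * Y) ^ e with hG
    set p : Polynomial ℝ := ∑ j, Polynomial.C (α j) * (Polynomial.C (u j * (U / N) + v j * (V / N)) +
      Polynomial.C (u j * V - v j * U) * Polynomial.X) ^ (e+1) with hp
    have pe : ∀ τ, p.eval τ = F (U / N + τ * V) (V / N - τ * U) := by
      intro τ
      simp only [hp, hF, Polynomial.eval_finsetSum, Polynomial.eval_mul, Polynomial.eval_pow,
        Polynomial.eval_add, Polynomial.eval_C, Polynomial.eval_X]
      refine Finset.sum_congr rfl fun j _ => ?_
      congr 2; ring
    have pd : ∀ τ, p.derivative.eval τ = (e+1) * G (U / N + τ * V) (V / N - τ * U) := by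
      intro τ
      simp only [hp, hG, Polynomial.derivative_sum, Polynomial.derivative_mul, Polynomial.derivative_C,
        Polynomial.derivative_pow, Polynomial.derivative_add, Polynomial.derivative_X,
        Polynomial.eval_finsetSum, Polynomial.eval_mul, Polynomial.eval_pow,
        Polynomial.eval_add, Polynomial.eval_C, Polynomial.eval_X]
      rw [Fin.sum_univ_succ, Finset.mul_sum]
      simp only [← hU, ← hV]
      rw [show U * V - V * U = 0 by ring]
      simp
      refine Finset.sum_congr rfl fun j _ => ?_
      rw [show u j.succ * (U / N) + v j.succ * (V / N) + (u j.succ * V - v j.succ * U) * τ =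
        u j.succ * (U / N + τ * V) + v j.succ * (V / N - τ * U) by ring]
      ring
    have FG : F V (-U) = G V (-U) := by
      simp only [hF, hG]
      rw [Fin.sum_univ_succ]
      simp only [← hU, ← hV]
      rw [show U * V + V * -U = 0 by ring]
      simp
      refine Finset.sum_congr rfl fun j _ => ?_
      rw [pow_succ]; ring
    have Fh : ∀ c X Y, F (c * X) (c * Y) = c ^ (e+1) * F X Y := by
      intro c X Y
      simp only [hF, Finset.mul_sum]
      refine Finset.sum_congr rfl fun j _ => ?_
      rw [show u j * (c * X) + v j * (c * Y) = c * (u j * X + v j * Y) by ring, mul_pow]; ring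
    have hline : ∀ X Y, U * X + V * Y ≠ 0 →
        F X Y = (U * X + V * Y) ^ (e+1) * p.eval ((V * X - U * Y) / (N * (U * X + V * Y))) := by
      intro X Y h
      rw [pe, ← Fh]
      obtain ⟨L, hL⟩ : ∃ L, L = U * X + V * Y := ⟨_, rfl⟩
      rw [← hL] at h ⊢
      congr 1
      · field_simp; rw [hNdef, hL]; ring
      · field_simp; rw [hNdef, hL]; ring
    have hinf : ∀ X Y, U * X + V * Y = 0 → F X Y = ((V * X - U * Y) / N) ^ (e+1) * F V (-U) := by
      intro X Y h
      rw [← Fh]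
      congr 1
      · field_simp; rw [hNdef]; linear_combination U * h
      · field_simp; rw [hNdef]; linear_combination V * h
    -- the zeros on the line
    set τ : Fin (e+1) → ℝ := fun i => (V * x i - U * y i) / (N * (U * x i + V * y i)) with hτ
    have hτ0 : ∀ i, U * x i + V * y i ≠ 0 → p.eval (τ i) = 0 := by
      intro i h
      have := hline _ _ h
      rw [show F (x i) (y i) = 0 from hz i] at this
      exact (mul_eq_zero.1 this.symm).resolve_left (pow_ne_zero _ h)
    have hτi : ∀ i j, U * x i + V * y i ≠ 0 → U * x j + V * y j ≠ 0 → τ i = τ j → i = j := by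
      intro i j h1 h2 h
      by_contra hij
      apply hi i j hij
      simp only [hτ] at h
      rw [div_eq_div_iff (by positivity) (by positivity)] at h
      have h3 : N * N * (x i * y j - x j * y i) = 0 := by
        rw [hNdef] at h ⊢; linear_combination h
      have h4 : N * N ≠ 0 := by positivity
      have := (mul_eq_zero.1 h3).resolve_left h4
      linarith
    have huniq : ∀ i j, U * x i + V * y i = 0 → U * x j + V * y j = 0 → i = j := by
      intro i j h1 h2
      by_contra hij
      apply hi i j hij
      have h3 : N * (x i * y j - x j * y i) = 0 := by
        rw [hNdef]; linear_combination (U * y j - V * x j) * h1 + (V * x i - U * y i) * h2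
      have := (mul_eq_zero.1 h3).resolve_left hN.ne'
      linarith
    have hGzero : ∀ X Y, G X Y = 0 := by
      by_cases hex : ∃ i0, U * x i0 + V * y i0 = 0
      · obtain ⟨i0, hi0⟩ := hex
        have hFw : F V (-U) = 0 := by
          have h1 := hinf _ _ hi0
          rw [show F (x i0) (y i0) = 0 from hz i0] at h1
          refine (mul_eq_zero.1 h1.symm).resolve_left (pow_ne_zero _ ?_)
          intro h2
          have h3 : V * x i0 - U * y i0 = 0 := by
            rcases div_eq_zero_iff.1 h2 with h | h
            · exact h
            · exact absurd h hN.ne'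
          have hx : N * x i0 = 0 := by rw [hNdef]; linear_combination U * hi0 + V * h3
          have hy : N * y i0 = 0 := by rw [hNdef]; linear_combination V * hi0 - U * h3
          rcases h0 i0 with h | h
          · exact h ((mul_eq_zero.1 hx).resolve_left hN.ne')
          · exact h ((mul_eq_zero.1 hy).resolve_left hN.ne')
        obtain ⟨S', hS', hc⟩ := rolle_finset p ((Finset.univ.erase i0).image τ) (by
          intro s hs
          simp only [Finset.mem_image, Finset.mem_erase, Finset.mem_univ, and_true] at hs
          obtain ⟨i, hi, rfl⟩ := hs
          exact hτ0 i (fun h => hi (huniq _ _ h hi0)))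
        rw [Finset.card_image_of_injOn (by
          intro i hi j hj h
          simp at hi hj
          exact hτi i j (fun h => hi (huniq _ _ h hi0)) (fun h => hj (huniq _ _ h hi0)) h)] at hc
        simp at hc
        obtain ⟨e', rfl⟩ : ∃ e', e = e' + 1 := ⟨e - 1, by omega⟩
        obtain ⟨f, hf, hfS⟩ := exists_inj_of_card (n := e') S' (by omega)
        refine ih (e'+1) (by omega) _ _ _ (Fin.cons V fun i => U / N + f i * V)
          (Fin.cons (-U) fun i => V / N - f i * U) ?_ ?_ ?_
        · intro i
          refine Fin.cases ?_ (fun i => ?_) i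
          · simp only [Fin.cons_zero]
            by_contra hcon
            push Not at hcon
            rw [hNdef, hcon.1, neg_eq_zero.1 hcon.2] at hN
            simp at hN
          · simp only [Fin.cons_succ]
            by_contra hcon
            push Not at hcon
            have : U * (U / N + f i * V) + V * (V / N - f i * U) = 1 := by
              field_simp; rw [hNdef]; ring
            rw [hcon.1, hcon.2] at this; simp at this
        · intro i j
          refine Fin.cases ?_ (fun i => ?_) i <;> refine Fin.cases ?_ (fun j => ?_) j
          · simp
          · intro _
            simp only [Fin.cons_zero, Fin.cons_succ]
            intro h
            have : (1:ℝ) = 0 := by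
              have h5 : V * (V / N) + U * (U / N) = 1 := by field_simp; rw [hNdef]; ring
              linear_combination h - h5
            simp at this
          · intro _
            simp only [Fin.cons_zero, Fin.cons_succ]
            intro h
            have : (1:ℝ) = 0 := by
              have h5 : V * (V / N) + U * (U / N) = 1 := by field_simp; rw [hNdef]; ring
              linear_combination -h - h5
            simp at this
          · intro hij
            simp only [Fin.cons_succ]
            intro h
            apply hij
            congr 1
            apply hf
            have h5 : V * (V / N) + U * (U / N) = 1 := by field_simp; rw [hNdef]; ring
            linear_combination -h5 * (f i - f j) + h
        · intro i
          refine Fin.cases ?_ (fun i => ?_) i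
          · simp only [Fin.cons_zero]
            rw [← hFw, FG]
          · simp only [Fin.cons_succ]
            have := hS' _ (hfS i)
            rw [pd] at this
            exact (mul_eq_zero.1 this).resolve_left (by positivity)
      · push Not at hex
        obtain ⟨S', hS', hc⟩ := rolle_finset p (Finset.univ.image τ) (by
          intro s hs
          simp only [Finset.mem_image, Finset.mem_univ, true_and] at hs
          obtain ⟨i, rfl⟩ := hs
          exact hτ0 i (hex i))
        rw [Finset.card_image_of_injOn (by
          intro i hi j hj h
          exact hτi i j (hex i) (hex j) h)] at hc
        simp at hc
        obtain ⟨f, hf, hfS⟩ := exists_inj_of_card (n := e) S' (by omega)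
        refine ih e (by omega) _ _ _ (fun i => U / N + f i * V)
          (fun i => V / N - f i * U) ?_ ?_ ?_
        · intro i
          by_contra hcon
          push Not at hcon
          have : U * (U / N + f i * V) + V * (V / N - f i * U) = 1 := by
            field_simp; rw [hNdef]; ring
          rw [hcon.1, hcon.2] at this; simp at this
        · intro i j hij h
          apply hij
          apply hf
          have h5 : V * (V / N) + U * (U / N) = 1 := by field_simp; rw [hNdef]; ring
          linear_combination -h5 * (f i - f j) + h
        · intro i
          have := hS' _ (hfS i)
          rw [pd] at this
          exact (mul_eq_zero.1 this).resolve_left (by positivity)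
    have hp' : p.derivative = 0 := Polynomial.funext fun t => by rw [pd, hGzero]; simp
    have hp0 : p = 0 := by
      have hc := Polynomial.eq_C_of_derivative_eq_zero hp'
      have : ∃ i, U * x i + V * y i ≠ 0 := by
        by_contra hcon
        push Not at hcon
        have h1 := huniq ⟨0, by omega⟩ ⟨1, by omega⟩ (hcon _) (hcon _)
        simp at h1
      obtain ⟨i, hi⟩ := this
      have h1 := hτ0 i hi
      rw [hc] at h1 ⊢
      simp at h1
      rw [h1]; simp
    intro X Y
    change F X Y = 0
    by_cases h : U * X + V * Y = 0
    · rw [hinf _ _ h, FG, hGzero]; simp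
    · rw [hline _ _ h, hp0]; simp

/-- Forms with `d` distinct real roots. -/
def HypSet (d : ℕ) : Set (Fin (d+1) → ℝ) :=
  {a | ∃ t : ℝ, t ≠ 0 ∧ ∃ A B : Fin d → ℝ,
            (∀ i, A i ≠ 0 ∨ B i ≠ 0) ∧
            (∀ i j, i ≠ j → A i * B j ≠ A j * B i) ∧
            binForm d a = C t * ∏ i, linForm (A i) (B i)}

lemma form_ext {K : Type} [Field K] [Infinite K] {p q : MvPolynomial (Fin 2) K}
    (h : ∀ x y, eval ![x, y] p = eval ![x, y] q) : p = q := by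
  apply MvPolynomial.funext
  intro x
  have : x = ![x 0, x 1] := by
    funext i; fin_cases i <;> rfl
  rw [this]; exact h _ _

lemma fe_ext {K : Type} [Field K] [Infinite K] {d : ℕ} {a b : Fin (d+1) → K}
    (h : ∀ x y, fe d a x y = fe d b x y) : a = b :=
  binForm_inj d (form_ext fun x y => by rw [eval_binForm, eval_binForm, h])

lemma mem_HypSet_of_zeros {d : ℕ} {a : Fin (d+1) → ℝ} (ha : a ≠ 0) (x y : Fin d → ℝ)
    (h0 : ∀ i, x i ≠ 0 ∨ y i ≠ 0) (hi : ∀ i j, i ≠ j → x i * y j ≠ x j * y i)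
    (hz : ∀ i, fe d a (x i) (y i) = 0) : a ∈ HypSet d := by
  obtain ⟨t, ht⟩ := factor_of_zeros d a x y h0 hi hz
  refine ⟨t, ?_, y, fun i => - x i, ?_, ?_, ht⟩
  · rintro rfl
    apply ha
    apply binForm_eq_zero
    rw [ht]; simp
  · intro i; rcases h0 i with h | h <;> simp [h]
  · intro i j hij h
    apply hi i j hij
    linear_combination h

lemma fe_of_prod {K : Type} [Field K] {d n : ℕ} {a : Fin (d+1) → K} {t : K} {A B : Fin n → K}
    (h : binForm d a = C t * ∏ i, linForm (A i) (B i)) (x y : K) :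
    fe d a x y = t * ∏ i, (A i * x + B i * y) := by
  rw [← eval_binForm, h, map_mul, eval_C, map_prod]
  simp only [eval_linForm]

lemma ne_zero_of_mem_HypSet {d : ℕ} {a : Fin (d+1) → ℝ} (h : a ∈ HypSet d) : a ≠ 0 := by
  obtain ⟨t, ht, A, B, h0, hi, hf⟩ := h
  rintro rfl
  rw [binForm_zero] at hf
  have := mul_ne_zero ((map_ne_zero_iff (C : ℝ →+* MvPolynomial (Fin 2) ℝ)
    (C_injective _ _)).2 ht)
    (Finset.prod_ne_zero_iff.2 fun i (_ : i ∈ Finset.univ) => linForm_ne_zero (h0 i))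
  exact this hf.symm

lemma zeros_of_mem_HypSet {d : ℕ} {a : Fin (d+1) → ℝ} (h : a ∈ HypSet d) :
    ∃ x y : Fin d → ℝ, (∀ i, x i ≠ 0 ∨ y i ≠ 0) ∧ (∀ i j, i ≠ j → x i * y j ≠ x j * y i) ∧
    (∀ i, fe d a (x i) (y i) = 0) := by
  obtain ⟨t, ht, A, B, h0, hi, hf⟩ := h
  refine ⟨B, fun i => - A i, ?_, ?_, ?_⟩
  · intro i; rcases h0 i with h | h <;> simp [h]
  · intro i j hij h; apply hi i j hij; linear_combination h
  · intro i
    rw [fe_of_prod hf, Finset.prod_eq_zero (Finset.mem_univ i), mul_zero]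
    ring

lemma continuous_fe (d : ℕ) (x y : ℝ) : Continuous fun a : Fin (d+1) → ℝ => fe d a x y := by
  unfold fe; fun_prop

lemma continuous_fe2 (d : ℕ) (a : Fin (d+1) → ℝ) : Continuous fun z : ℝ × ℝ => fe d a z.1 z.2 := by
  unfold fe; fun_prop

open Filter Topology in
lemma isOpen_HypSet (d : ℕ) : IsOpen (HypSet d) := by
  rw [isOpen_iff_mem_nhds]
  intro a ha
  have hane := ne_zero_of_mem_HypSet ha
  obtain ⟨t, ht, A, B, h0, hi, hf⟩ := ha
  have hN : ∀ i, 0 < A i ^ 2 + B i ^ 2 := by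
    intro i
    rcases h0 i with h | h <;> positivity
  -- independence of perturbed zeros
  have h1 : ∀ᶠ τ : Fin d → ℝ in 𝓝 0, ∀ i j, i ≠ j →
      (B i + τ i * A i) * (-A j + τ j * B j) - (B j + τ j * A j) * (-A i + τ i * B i) ≠ 0 := by
    rw [eventually_all]; intro i
    rw [eventually_all]; intro j
    by_cases hij : i = j
    · simp [hij]
    have hc : Continuous fun τ : Fin d → ℝ =>
      (B i + τ i * A i) * (-A j + τ j * B j) - (B j + τ j * A j) * (-A i + τ i * B i) := by fun_prop
    have := hc.continuousAt.eventually_ne (x := (0 : Fin d → ℝ)) (y := (0:ℝ)) (by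
      simp only [Pi.zero_apply]
      intro h
      apply hi i j hij
      linear_combination h)
    filter_upwards [this] with τ hτ _ using hτ
  obtain ⟨ε, hε, hball⟩ := Metric.eventually_nhds_iff.1 h1
  -- sign changes
  have h2 : ∀ᶠ δ : ℝ in 𝓝[>] 0, ∀ i,
      fe d a (B i + δ * A i) (-A i + δ * B i) * fe d a (B i + (-δ) * A i) (-A i + (-δ) * B i) < 0 := by
    rw [eventually_all]; intro i
    let g : ℝ → ℝ := fun δ => t * ∏ j ∈ Finset.univ.erase i,
      (A j * (B i + δ * A i) + B j * (-A i + δ * B i))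
    have hg : Continuous g := by fun_prop
    have hfe : ∀ δ, fe d a (B i + δ * A i) (-A i + δ * B i) = δ * (A i ^ 2 + B i ^ 2) * g δ := by
      intro δ
      rw [fe_of_prod hf, ← Finset.mul_prod_erase _ _ (Finset.mem_univ i)]
      simp only [g]; ring
    have hg0 : g 0 ≠ 0 := by
      refine mul_ne_zero ht (Finset.prod_ne_zero_iff.2 fun j hj => ?_)
      intro h
      apply hi j i (by simpa using hj)
      linear_combination h
    have hgg : Continuous fun δ => g δ * g (-δ) := by fun_prop
    have : ∀ᶠ δ in 𝓝 (0:ℝ), 0 < g δ * g (-δ) :=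
      hgg.continuousAt.eventually_const_lt (by simpa using mul_self_pos.2 hg0)
    filter_upwards [this.filter_mono nhdsWithin_le_nhds, self_mem_nhdsWithin] with δ h3 h4
    rw [hfe, hfe]
    have h4 : (0:ℝ) < δ := h4
    have : 0 < (δ * (A i ^ 2 + B i ^ 2)) ^ 2 := by have := hN i; positivity
    nlinarith [mul_pos this h3]
  have h3 : ∀ᶠ δ : ℝ in 𝓝[>] 0, δ < ε :=
    (eventually_lt_nhds hε).filter_mono nhdsWithin_le_nhds
  obtain ⟨δ, ⟨hδ, hδε⟩, hδ0⟩ := ((h2.and h3).and self_mem_nhdsWithin).exists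
  have hδ0 : (0:ℝ) < δ := hδ0
  have h4 : ∀ᶠ b in 𝓝 a, ∀ i,
      fe d b (B i + δ * A i) (-A i + δ * B i) * fe d b (B i + (-δ) * A i) (-A i + (-δ) * B i) < 0 := by
    rw [eventually_all]; intro i
    exact ((continuous_fe d _ _).mul (continuous_fe d _ _)).continuousAt.eventually_lt_const (hδ i)
  have h5 : ∀ᶠ b in 𝓝 a, b ≠ 0 := eventually_ne_nhds hane
  filter_upwards [h4, h5] with b hb hb0
  have hex : ∀ i, ∃ τ ∈ Set.Icc (-δ) δ, fe d b (B i + τ * A i) (-A i + τ * B i) = 0 := by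
    intro i
    have hc : Continuous fun τ : ℝ => fe d b (B i + τ * A i) (-A i + τ * B i) :=
      (continuous_fe2 d b).comp (by fun_prop : Continuous fun τ : ℝ => ((B i + τ * A i, -A i + τ * B i) : ℝ × ℝ))
    have hle : -δ ≤ δ := by linarith
    rcases mul_neg_iff.1 (hb i) with ⟨h6, h7⟩ | ⟨h6, h7⟩
    · obtain ⟨τ, hτ, h8⟩ := intermediate_value_Icc hle hc.continuousOn ⟨h7.le, h6.le⟩
      exact ⟨τ, hτ, h8⟩
    · obtain ⟨τ, hτ, h8⟩ := intermediate_value_Icc' hle hc.continuousOn ⟨h6.le, h7.le⟩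
      exact ⟨τ, hτ, h8⟩
  choose τ hτ hτ0 using hex
  refine mem_HypSet_of_zeros hb0 (fun i => B i + τ i * A i) (fun i => -A i + τ i * B i) ?_ ?_ hτ0
  · intro i
    by_contra hcon
    push Not at hcon
    have : A i ^ 2 + B i ^ 2 = 0 := by linear_combination B i * hcon.1 - A i * hcon.2
    exact (hN i).ne' this
  · intro i j hij h
    refine hball (y := τ) ?_ i j hij (sub_eq_zero.2 h)
    rw [dist_pi_lt_iff hε]
    intro i
    simp only [Pi.zero_apply, dist_zero_right, Real.norm_eq_abs]
    exact (abs_le.2 (hτ i)).trans_lt hδε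

lemma linForm_pow {K : Type} [CommSemiring K] (d : ℕ) (u v : K) :
    (linForm u v) ^ d = binForm d (fun i => (d.choose i : K) * u ^ (d - (i:ℕ)) * v ^ (i:ℕ)) := by
  rw [linForm, add_comm, add_pow, Finset.sum_range, binForm]
  refine Finset.sum_congr rfl fun i _ => ?_
  simp [mul_pow]
  ring

lemma binForm_powsum {K : Type} [CommSemiring K] (d r : ℕ) (α u v : Fin r → K) :
    ∑ j, α j • (linForm (u j) (v j)) ^ d =
      binForm d (fun i => ∑ j, α j * ((d.choose i : K) * u j ^ (d - (i:ℕ)) * v j ^ (i:ℕ))) := by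
  have : ∀ n (f : Fin n → Fin (d+1) → K), binForm d (∑ j, f j) = ∑ j, binForm d (f j) := by
    intro n f
    induction n with
    | zero => simp [binForm_zero]
    | succ n ih => rw [Fin.sum_univ_succ, binForm_add, ih, Fin.sum_univ_succ]
  rw [show (fun i : Fin (d+1) => ∑ j, α j * ((d.choose i : K) * u j ^ (d - (i:ℕ)) * v j ^ (i:ℕ))) =
    ∑ j, (α j • fun i : Fin (d+1) => ((d.choose i : K) * u j ^ (d - (i:ℕ)) * v j ^ (i:ℕ))) by
      funext i; simp, this]
  refine Finset.sum_congr rfl fun j _ => ?_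
  rw [linForm_pow, binForm_smul, smul_eq_C_mul]

lemma hyp_not_powsum {d r : ℕ} (hr : r < d) {a : Fin (d+1) → ℝ} (ha : a ∈ HypSet d)
    (α u v : Fin r → ℝ) : binForm d a ≠ ∑ j, α j • (linForm (u j) (v j)) ^ d := by
  intro h
  obtain ⟨x, y, h0, hi, hz⟩ := zeros_of_mem_HypSet ha
  have he : ∀ x y, fe d a x y = ∑ j, α j * (u j * x + v j * y) ^ d := by
    intro x y
    rw [← eval_binForm, h, map_sum]
    simp [smul_eq_C_mul, eval_linForm]
  have := powsum_zero r d hr α u v x y h0 hi (fun i => by rw [← he]; exact hz i)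
  apply ne_zero_of_mem_HypSet ha
  apply fe_ext
  intro x y
  rw [he, this]; simp [fe]

lemma hyp_powsum {d : ℕ} (hd : Odd d) {a : Fin (d+1) → ℝ} (ha : a ∈ HypSet d) :
    ∃ α u v : Fin d → ℝ, binForm d a = ∑ j, α j • (linForm (u j) (v j)) ^ d := by
  obtain ⟨t, ht, A, B, h0, hi, hf⟩ := ha
  let P : Fin d → Fin (d+1) → ℝ := fun j i => (d.choose i : ℝ) * A j ^ (d - (i:ℕ)) * B j ^ (i:ℕ)
  have hmem : a ∈ Submodule.span ℝ (Set.range P) := by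
    by_contra hcon
    obtain ⟨φ, hφ, hker⟩ := Submodule.exists_le_ker_of_notMem hcon
    apply hφ
    have hφs : ∀ b : Fin (d+1) → ℝ, φ b = ∑ i, b i * φ (Pi.single i 1) := by
      intro b
      conv_lhs => rw [← Finset.univ_sum_single b, map_sum]
      refine Finset.sum_congr rfl fun i _ => ?_
      rw [← smul_eq_mul, ← map_smul, ← Pi.single_smul]; simp
    let h : Fin (d+1) → ℝ := fun i => φ (Pi.single i 1) * d.choose i
    obtain ⟨s, hs⟩ := factor_of_zeros d h A B h0 hi (by
      intro j
      have : φ (P j) = 0 := hker (Submodule.subset_span ⟨j, rfl⟩)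
      rw [hφs] at this
      rw [← this]
      unfold fe
      refine Finset.sum_congr rfl fun i _ => ?_
      simp only [h, P]; ring)
    let ra : Fin (d+1) → ℝ := fun i => a i.rev * (-1) ^ (i:ℕ)
    have hra : ∀ x y, fe d ra x y = fe d a (-y) x := by
      intro x y
      unfold fe
      rw [← Equiv.sum_comp Fin.revPerm]
      refine Finset.sum_congr rfl fun i _ => ?_
      have hi := i.2
      simp only [ra, Fin.revPerm_apply, Fin.rev_rev, Fin.val_rev]
      rw [show d + 1 - ((i:ℕ) + 1) = d - i by omega, show d - (d - (i:ℕ)) = i by omega, neg_pow y]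
      ring
    have hth : t • h = s • ra := by
      apply fe_ext
      intro x y
      have e1 : fe d (t • h) x y = t * fe d h x y := (feL d x y).map_smul t h
      have e2 : fe d (s • ra) x y = s * fe d ra x y := (feL d x y).map_smul s ra
      rw [e1, e2, hra, fe_of_prod hs, fe_of_prod hf]
      rw [mul_left_comm]
      congr 2
      refine Finset.prod_congr rfl fun i _ => ?_
      ring
    have hsum : ∑ i : Fin (d+1), a i * (ra i / d.choose i) = 0 := by
      have e3 : ∑ i : Fin (d+1), a i * (ra i / d.choose i) = - ∑ i : Fin (d+1), a i * (ra i / d.choose i) := by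
        conv_lhs => rw [← Equiv.sum_comp Fin.revPerm]
        rw [← Finset.sum_neg_distrib]
        refine Finset.sum_congr rfl fun i _ => ?_
        have hi := i.2
        simp only [ra, Fin.revPerm_apply, Fin.rev_rev, Fin.val_rev]
        rw [show d + 1 - ((i:ℕ) + 1) = d - i by omega, Nat.choose_symm (by omega)]
        have : (-1:ℝ) ^ (d - (i:ℕ)) = - (-1) ^ (i:ℕ) := by
          have h1 : (-1:ℝ) ^ (d - (i:ℕ)) * (-1) ^ (i:ℕ) = -1 := by
            rw [← pow_add, show d - (i:ℕ) + i = d by omega, hd.neg_one_pow]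
          have h2 : (-1:ℝ) ^ (i:ℕ) * (-1) ^ (i:ℕ) = 1 := by
            rw [← mul_pow]; simp
          linear_combination (-1:ℝ)^(i:ℕ) * h1 - (-1:ℝ)^(d - (i:ℕ)) * h2
        rw [this]; ring
      linarith
    have : t * φ a = 0 := by
      rw [hφs, Finset.mul_sum]
      rw [← mul_zero s, ← hsum, Finset.mul_sum]
      refine Finset.sum_congr rfl fun i _ => ?_
      have h5 := congrFun hth i
      simp only [Pi.smul_apply, smul_eq_mul, h] at h5
      have h6 : (d.choose i : ℝ) ≠ 0 := by
        have := Nat.choose_pos (n := d) (k := i) (by have := i.2; omega)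
        positivity
      field_simp
      linear_combination a i * h5
    exact (mul_eq_zero.1 this).resolve_left ht
  obtain ⟨α, hα⟩ := (Submodule.mem_span_range_iff_exists_fun ℝ).1 hmem
  refine ⟨α, A, B, ?_⟩
  rw [binForm_powsum]
  congr 1
  rw [← hα]
  funext i
  simp [P]

lemma hyp_waringRank {d : ℕ} (hd : Odd d) : HypSet d ⊆ realRankSet d d := by
  intro a ha
  apply le_antisymm
  · exact Nat.sInf_le (hyp_powsum hd ha)
  · refine le_csInf ⟨d, hyp_powsum hd ha⟩ ?_
    rintro r ⟨α, u, v, h⟩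
    by_contra hr
    exact hyp_not_powsum (not_le.1 hr) ha α u v h

lemma hyp_subset_Rdr {d : ℕ} (hd : Odd d) : HypSet d ⊆ Rdr d d :=
  interior_maximal (hyp_waringRank hd) (isOpen_HypSet d)

/-- Normalized directional derivative in normalized coordinates. -/
def DD (d : ℕ) (s t : ℝ) : (Fin (d+2) → ℝ) →ₗ[ℝ] (Fin (d+1) → ℝ) where
  toFun c := fun i => s * c i.castSucc + t * c i.succ
  map_add' a b := by funext i; simp; ring
  map_smul' a b := by funext i; simp; ring

lemma DD_apply (d : ℕ) (s t : ℝ) (c) (i) : DD d s t c i = s * c i.castSucc + t * c i.succ := rfl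

lemma DD_surj (d : ℕ) (s t : ℝ) (h : s ≠ 0 ∨ t ≠ 0) : Function.Surjective (DD d s t) := by
  rcases h with h | h
  · induction d with
    | zero =>
      intro e
      refine ⟨![e 0 / s, 0], ?_⟩
      funext i
      fin_cases i
      simp [DD_apply]
      field_simp
    | succ d ih =>
      intro e
      obtain ⟨c, hc⟩ := ih (fun i => e i.succ)
      refine ⟨Fin.cons ((e 0 - t * c 0) / s) c, ?_⟩
      funext i
      refine Fin.cases ?_ (fun i => ?_) i
      · simp [DD_apply]; field_simp; ring
      · rw [DD_apply, ← Fin.succ_castSucc, Fin.cons_succ, Fin.cons_succ]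
        exact congrFun hc i
  · induction d with
    | zero =>
      intro e
      refine ⟨![0, e 0 / t], ?_⟩
      funext i
      fin_cases i
      simp [DD_apply]
      field_simp
    | succ d ih =>
      intro e
      obtain ⟨c, hc⟩ := ih (fun i => e i.castSucc)
      refine ⟨Fin.snoc (α := fun _ => ℝ) c ((e (Fin.last _) - s * c (Fin.last _)) / t), ?_⟩
      funext i
      refine Fin.lastCases ?_ (fun i => ?_) i
      · simp [DD_apply]; field_simp; ring
      · rw [DD_apply, Fin.succ_castSucc, Fin.snoc_castSucc, Fin.snoc_castSucc]
        exact congrFun hc i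

lemma DD_open (d : ℕ) (s t : ℝ) (h : s ≠ 0 ∨ t ≠ 0) : IsOpenMap (DD d s t) :=
  LinearMap.isOpenMap_of_finiteDimensional _ (DD_surj d s t h)

lemma DD_ker (d : ℕ) (s t : ℝ) (h : s ≠ 0 ∨ t ≠ 0) (w : Fin (d+2) → ℝ) (hw : DD d s t w = 0) :
    ∃ κ : ℝ, ∀ i : Fin (d+2), w i = κ * t ^ (d + 1 - (i:ℕ)) * (-s) ^ (i:ℕ) := by
  have hw' : ∀ i : Fin (d+1), s * w i.castSucc + t * w i.succ = 0 := fun i => congrFun hw i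
  by_cases ht : t = 0
  · subst ht
    have hs : s ≠ 0 := by simpa using h
    refine ⟨w (Fin.last _) / (-s) ^ (d+1), fun i => ?_⟩
    refine Fin.lastCases ?_ (fun i => ?_) i
    · have : (-s) ^ (d+1) ≠ 0 := pow_ne_zero _ (neg_ne_zero.2 hs)
      simp; field_simp
    · have := hw' i
      simp [hs] at this
      rw [this, Fin.val_castSucc, zero_pow (by omega)]
      simp
  · refine ⟨w 0 / t ^ (d+1), fun i => ?_⟩
    induction i using Fin.induction with
    | zero => simp; field_simp
    | succ i ih =>
      have h1 := hw' i
      rw [ih] at h1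
      have h2 : d + 1 - (i.castSucc : ℕ) = (d + 1 - (i.succ : ℕ)) + 1 := by simp; omega
      rw [h2, pow_succ] at h1
      apply mul_left_cancel₀ ht
      simp only [Fin.val_castSucc, Fin.val_succ] at h1 ⊢
      rw [pow_succ (-s)]
      linear_combination h1

/-- Sum of `r` powers, in normalized coordinates. -/
def SP (d r : ℕ) (c : Fin (d+1) → ℝ) : Prop :=
  ∃ α u v : Fin r → ℝ, ∀ i : Fin (d+1), c i = ∑ j, α j * (u j ^ (d - (i:ℕ)) * v j ^ (i:ℕ))

open Filter Topology in
lemma SP_step (d r : ℕ) (s t : ℝ) (h : s ≠ 0 ∨ t ≠ 0) (c : Fin (d+2) → ℝ)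
    (hc : c ∈ interior {c | ¬ SP (d+1) (r+1) c}) :
    DD d s t c ∈ interior {c | ¬ SP d r c} := by
  set V := interior {c | ¬ SP (d+1) (r+1) c} with hV
  have hVo : IsOpen (DD d s t '' V) := DD_open d s t h _ isOpen_interior
  refine mem_interior.2 ⟨_, ?_, hVo, ⟨c, hc, rfl⟩⟩
  rintro _ ⟨c, hc, rfl⟩ ⟨α, u, v, hs⟩
  have hN : s ^ 2 + t ^ 2 ≠ 0 := by
    have : 0 < s ^ 2 + t ^ 2 := by rcases h with h | h <;> positivity
    exact this.ne'
  let e : ℝ → (Fin (d+1) → ℝ) := fun η i =>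
    ∑ j, α j * ((u j + η * s) ^ (d - (i:ℕ)) * (v j + η * t) ^ (i:ℕ))
  have he : Continuous e := by fun_prop
  have he0 : e 0 = DD d s t c := by
    funext i; rw [hs i]; simp [e]
  have h1 : ∀ᶠ η in 𝓝[≠] (0:ℝ), e η ∈ DD d s t '' V := by
    apply eventually_nhdsWithin_of_eventually_nhds
    apply he.continuousAt.eventually_mem
    rw [he0]
    exact hVo.mem_nhds ⟨c, hc, rfl⟩
  have h2 : ∀ᶠ η in 𝓝[≠] (0:ℝ), ∀ j, s * (u j + η * s) + t * (v j + η * t) ≠ 0 := by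
    rw [eventually_all]; intro j
    by_cases hz : s * u j + t * v j = 0
    · filter_upwards [self_mem_nhdsWithin] with η hη h3
      have : η * (s ^ 2 + t ^ 2) = 0 := by linear_combination h3 - hz
      rcases mul_eq_zero.1 this with h4 | h4
      · exact hη h4
      · exact hN h4
    · apply eventually_nhdsWithin_of_eventually_nhds
      have hcont : Continuous fun η : ℝ => s * (u j + η * s) + t * (v j + η * t) := by fun_prop
      exact hcont.continuousAt.eventually_ne (by simpa using hz)
  obtain ⟨η, ⟨c', hc', hce⟩, hL⟩ := (h1.and h2).exists
  set U := fun j => u j + η * s with hU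
  set W := fun j => v j + η * t with hW
  let c'' : Fin (d+2) → ℝ := fun i =>
    ∑ j, α j / (s * U j + t * W j) * (U j ^ (d + 1 - (i:ℕ)) * W j ^ (i:ℕ))
  have hc'' : DD d s t c'' = e η := by
    funext i
    simp only [DD_apply, c'', e, Finset.mul_sum, ← Finset.sum_add_distrib]
    refine Finset.sum_congr rfl fun j _ => ?_
    have hLj : s * U j + t * W j ≠ 0 := hL j
    have h2 : d + 1 - (i.castSucc : ℕ) = (d - (i : ℕ)) + 1 := by simp; omega
    have h3 : d + 1 - (i.succ : ℕ) = (d - (i : ℕ)) := by simp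
    rw [h2, h3, Fin.val_castSucc, Fin.val_succ]
    change _ = α j * (U j ^ _ * W j ^ _)
    field_simp
    ring
  obtain ⟨κ, hκ⟩ := DD_ker d s t h (c' - c'') (by rw [map_sub, hce, hc'', sub_self])
  have hmem : c' ∈ {c | ¬ SP (d+1) (r+1) c} := interior_subset hc'
  apply hmem
  refine ⟨Fin.cons κ (fun j => α j / (s * U j + t * W j)), Fin.cons t U, Fin.cons (-s) W, ?_⟩
  intro i
  rw [Fin.sum_univ_succ]
  simp only [Fin.cons_zero, Fin.cons_succ]
  have := hκ i
  simp only [Pi.sub_apply, c''] at this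
  linear_combination this


lemma cubic_SP (c : Fin 4 → ℝ)
    (h : 0 < (c 1 * c 2 - c 0 * c 3) ^ 2 - 4 * (c 1 * c 3 - c 2 ^ 2) * (c 0 * c 2 - c 1 ^ 2)) :
    SP 3 2 c := by
  set A := c 1 * c 3 - c 2 ^ 2 with hA
  set B := c 1 * c 2 - c 0 * c 3 with hB
  set C := c 0 * c 2 - c 1 ^ 2 with hC
  have r1 : A * c 0 + B * c 1 + C * c 2 = 0 := by rw [hA, hB, hC]; ring
  have r2 : A * c 1 + B * c 2 + C * c 3 = 0 := by rw [hA, hB, hC]; ring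
  by_cases hC0 : C = 0
  · have hB0 : B ≠ 0 := by
      rintro hB0; rw [hB0, hC0] at h; simp at h
    have e1 : c 1 = - A * c 0 / B := by field_simp; rw [hC0] at r1; linear_combination r1
    have e2 : c 2 = - A * c 1 / B := by field_simp; rw [hC0] at r2; linear_combination r2
    refine ⟨![c 0 / B ^ 3, c 3 + A ^ 3 * c 0 / B ^ 3], ![B, 0], ![-A, 1], ?_⟩
    clear_value A B C
    intro i
    fin_cases i
    · simp; field_simp
    · simp; rw [e1]; field_simp
    · simp; rw [e2, e1]; field_simp
    · simp; field_simp; ring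
  · set D := Real.sqrt (B ^ 2 - 4 * A * C) with hD
    have hD2 : D ^ 2 = B ^ 2 - 4 * A * C := Real.sq_sqrt h.le
    have hD0 : D ≠ 0 := (Real.sqrt_pos.2 h).ne'
    clear_value A B C D
    set x := (-B + D) / (2 * C) with hx
    set y := (-B - D) / (2 * C) with hy
    have hxy : x - y = D / C := by rw [hx, hy]; field_simp; ring
    have hxy0 : x - y ≠ 0 := by rw [hxy]; exact div_ne_zero hD0 hC0
    have ex : C * x ^ 2 = - A - B * x := by
      rw [hx]; field_simp; linear_combination hD2
    have ey : C * y ^ 2 = - A - B * y := by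
      rw [hy]; field_simp; linear_combination hD2
    clear_value x y
    set α := (c 1 - c 0 * y) / (x - y) with hα
    set β := (c 0 * x - c 1) / (x - y) with hβ
    have q0 : α + β = c 0 := by rw [hα, hβ]; field_simp; ring
    have q1 : α * x + β * y = c 1 := by rw [hα, hβ]; field_simp; ring
    clear_value α β
    have q2 : α * x ^ 2 + β * y ^ 2 = c 2 := by
      apply mul_left_cancel₀ hC0
      linear_combination α * ex + β * ey - A * q0 - B * q1 - r1
    have q3 : α * x ^ 3 + β * y ^ 3 = c 3 := by
      apply mul_left_cancel₀ hC0
      linear_combination α * x * ex + β * y * ey - A * q1 - B * q2 - r2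
    refine ⟨![α, β], ![1, 1], ![x, y], ?_⟩
    intro i
    fin_cases i
    · simp [q0]
    · simp [q1]
    · simp [q2]
    · simp [q3]

lemma hess_syz (c0 c1 c2 c3 s t : ℝ)
    (h : 0 < (s * c0 + t * c1) * (s * c2 + t * c3) - (s * c1 + t * c2) ^ 2) :
    0 < (c1 * c2 - c0 * c3) ^ 2 - 4 * (c1 * c3 - c2 ^ 2) * (c0 * c2 - c1 ^ 2) := by
  set A := c1 * c3 - c2 ^ 2 with hA
  set B := c1 * c2 - c0 * c3 with hB
  set C := c0 * c2 - c1 ^ 2 with hC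
  set H := (s * c0 + t * c1) * (s * c2 + t * c3) - (s * c1 + t * c2) ^ 2 with hH
  set f := c0 * s ^ 3 + 3 * c1 * s ^ 2 * t + 3 * c2 * s * t ^ 2 + c3 * t ^ 3 with hf
  have key : f ^ 2 * (B ^ 2 - 4 * A * C) =
      ((c0 * s ^ 2 + 2 * c1 * s * t + c2 * t ^ 2) * (- B * s + 2 * A * t)
        - (c1 * s ^ 2 + 2 * c2 * s * t + c3 * t ^ 2) * (2 * C * s - B * t)) ^ 2 + 4 * H ^ 3 := by
    rw [hA, hB, hC, hH, hf]; ring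
  have h3 : 0 < H ^ 3 := by positivity
  by_contra hcon
  push Not at hcon
  nlinarith [mul_nonneg (sq_nonneg f) (neg_nonneg.2 hcon), sq_nonneg ((c0 * s ^ 2 + 2 * c1 * s * t + c2 * t ^ 2) * (- B * s + 2 * A * t)
        - (c1 * s ^ 2 + 2 * c2 * s * t + c3 * t ^ 2) * (2 * C * s - B * t))]

open Filter Topology in
/-- In an open set around `e` with `e0 e2 - e1^2 ≥ 0` there is a point with `> 0`. -/
lemma perturb_pos (W : Set (Fin 3 → ℝ)) (hW : IsOpen W) (e : Fin 3 → ℝ) (he : e ∈ W)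
    (h : e 1 ^ 2 ≤ e 0 * e 2) : ∃ e' ∈ W, e' 1 ^ 2 < e' 0 * e' 2 := by
  obtain ⟨σ, hσ0, hσ⟩ : ∃ σ : ℝ, σ ^ 2 = 1 ∧ 0 ≤ σ * (e 0 + e 2) := by
    rcases le_total 0 (e 0 + e 2) with h | h
    · exact ⟨1, by norm_num, by linarith⟩
    · exact ⟨-1, by norm_num, by linarith⟩
  let g : ℝ → (Fin 3 → ℝ) := fun δ => ![e 0 + δ * σ, e 1, e 2 + δ * σ]
  have hg : Continuous g := by
    refine continuous_pi fun i => ?_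
    fin_cases i <;> simp [g] <;> fun_prop
  have hg0 : g 0 = e := by
    funext i; fin_cases i <;> simp [g]
  have h1 : ∀ᶠ δ in 𝓝[>] (0:ℝ), g δ ∈ W := by
    apply eventually_nhdsWithin_of_eventually_nhds
    apply hg.continuousAt.eventually_mem
    rw [hg0]; exact hW.mem_nhds he
  obtain ⟨δ, hδ, hδ0⟩ := (h1.and self_mem_nhdsWithin).exists
  have hδ0 : 0 < δ := hδ0
  refine ⟨g δ, hδ, ?_⟩
  simp only [g, Matrix.cons_val]
  nlinarith [mul_nonneg hδ0.le hσ, sq_nonneg (δ * σ), mul_pos hδ0 hδ0, congrArg (fun z => δ ^ 2 * z) hσ0]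

lemma cubic_hess (c : Fin 4 → ℝ) (hc : c ∈ interior {c | ¬ SP 3 2 c}) (s t : ℝ)
    (h : s ≠ 0 ∨ t ≠ 0) : (DD 2 s t c) 0 * (DD 2 s t c) 2 < (DD 2 s t c) 1 ^ 2 := by
  by_contra hcon
  push Not at hcon
  obtain ⟨_, ⟨c', hc', rfl⟩, hp⟩ := perturb_pos _ (DD_open 2 s t h _ isOpen_interior) _ ⟨c, hc, rfl⟩ hcon
  have hmem : c' ∈ {c | ¬ SP 3 2 c} := interior_subset hc'
  apply hmem
  apply cubic_SP
  apply hess_syz _ _ _ _ s t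
  simp only [DD_apply] at hp
  have e1 : (Fin.castSucc (0 : Fin 3) : Fin 4) = 0 := rfl
  have e2 : (Fin.castSucc (1 : Fin 3) : Fin 4) = 1 := rfl
  have e3 : (Fin.castSucc (2 : Fin 3) : Fin 4) = 2 := rfl
  have e4 : (Fin.succ (0 : Fin 3) : Fin 4) = 1 := rfl
  have e5 : (Fin.succ (1 : Fin 3) : Fin 4) = 2 := rfl
  have e6 : (Fin.succ (2 : Fin 3) : Fin 4) = 3 := rfl
  rw [e1, e2, e3, e4, e5, e6] at hp
  linarith

/-- All iterated derivatives down to quadrics are indefinite. -/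
def AH : (n : ℕ) → (Fin (n+3) → ℝ) → Prop
  | 0, c => c 0 * c 2 < c 1 ^ 2
  | n+1, c => ∀ s t : ℝ, (s ≠ 0 ∨ t ≠ 0) → AH n (DD (n+2) s t c)

/-- Weak version. -/
def AHw : (n : ℕ) → (Fin (n+3) → ℝ) → Prop
  | 0, c => c 0 * c 2 ≤ c 1 ^ 2
  | n+1, c => ∀ s t : ℝ, (s ≠ 0 ∨ t ≠ 0) → AHw n (DD (n+2) s t c)

lemma AH_of_SP (n : ℕ) (c : Fin (n+4) → ℝ) (hc : c ∈ interior {c | ¬ SP (n+3) (n+2) c}) :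
    AH (n+1) c := by
  induction n with
  | zero => intro s t h; exact cubic_hess c hc s t h
  | succ n ih =>
    intro s t h
    exact ih _ (SP_step _ _ s t h c hc)

lemma AHw_of_AH (n : ℕ) (c : Fin (n+3) → ℝ) (h : AH n c) : AHw n c := by
  induction n with
  | zero => exact le_of_lt h
  | succ n ih => intro s t hs; exact ih _ (h s t hs)

lemma AHw_closed (n : ℕ) : IsClosed {c | AHw n c} := by
  induction n with
  | zero => exact isClosed_le (by fun_prop) (by fun_prop)
  | succ n ih =>
    have : {c | AHw (n+1) c} = ⋂ (s : ℝ) (t : ℝ) (_ : s ≠ 0 ∨ t ≠ 0), DD (n+2) s t ⁻¹' {c | AHw n c} := by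
      ext c; simp [AHw]
    rw [this]
    refine isClosed_iInter fun s => isClosed_iInter fun t => isClosed_iInter fun h => ?_
    exact ih.preimage (LinearMap.continuous_of_finiteDimensional _)

lemma AH_of_interior (n : ℕ) (c : Fin (n+3) → ℝ) (h : c ∈ interior {c | AHw n c}) : AH n c := by
  induction n with
  | zero =>
    by_contra hcon
    simp only [AH, not_lt] at hcon
    obtain ⟨e, he, hp⟩ := perturb_pos _ isOpen_interior c h hcon
    have h0 : e ∈ {c | AHw 0 c} := interior_subset he
    have h1 : e 0 * e 2 ≤ e 1 ^ 2 := h0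
    linarith
  | succ n ih =>
    intro s t hs
    apply ih
    refine mem_interior.2 ⟨_, ?_, DD_open (n+2) s t hs _ isOpen_interior, ⟨c, h, rfl⟩⟩
    rintro _ ⟨e, he, rfl⟩
    have h0 : e ∈ {c | AHw (n+1) c} := interior_subset he
    exact h0 s t hs


lemma prod_of_card {g : Polynomial ℝ} {m : ℕ} (hg : g.natDegree = m)
    (hs : g.roots.toFinset.card = m) :
    g = Polynomial.C g.leadingCoeff * Lagrange.nodal g.roots.toFinset id := by
  have h1 := Polynomial.card_roots' g
  have h2 := Multiset.toFinset_card_le g.roots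
  have h3 : g.roots.card = g.natDegree := by omega
  have h4 : g.roots.Nodup := by
    rw [← Multiset.toFinset_card_eq_card_iff_nodup]; omega
  conv_lhs => rw [← Polynomial.C_leadingCoeff_mul_prod_multiset_X_sub_C h3]
  congr 1
  rw [Lagrange.nodal_eq, Finset.prod, Multiset.toFinset_val, h4.dedup]
  rfl

lemma critK_im (p : Polynomial ℝ) (m : ℕ) (hp : p.natDegree = m+1)
    (hs : p.derivative.roots.toFinset.card = m)
    (h : ∀ x, p.derivative.eval x = 0 → p.eval x * p.derivative.derivative.eval x < 0)
    (z : ℂ) (hz : (p.map (algebraMap ℝ ℂ)).eval z = 0) : z.im = 0 := by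
  by_contra him
  set s := p.derivative.roots.toFinset with hsdef
  set A := p.leadingCoeff with hA
  have hp0 : p ≠ 0 := by rintro rfl; simp at hp
  have hA0 : A ≠ 0 := by simpa [hA] using hp0
  have hdeg : p.derivative.natDegree = m := by
    rw [Polynomial.natDegree_derivative, hp]; rfl
  have hlc : p.derivative.leadingCoeff = A * (m + 1) := by
    rw [Polynomial.leadingCoeff, hdeg, Polynomial.coeff_derivative, hA, Polynomial.leadingCoeff, hp]
  have hd : p.derivative = Polynomial.C (A * (m+1)) * Lagrange.nodal s id := by
    rw [← hlc]; exact prod_of_card hdeg hs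
  set N := Lagrange.nodal s (id : ℝ → ℝ) with hN
  have hNm : N.Monic := Lagrange.nodal_monic
  have hNd : N.natDegree = m := by rw [hN, Lagrange.natDegree_nodal, hs]
  have hp'0 : p.derivative ≠ 0 := by
    intro h0; rw [h0] at hlc; simp at hlc
    rcases hlc with h | h
    · exact hA0 h
    · have : (0:ℝ) < m + 1 := by positivity
      exact this.ne' h
  set r := p %ₘ N with hr
  set q := p /ₘ N with hq
  have hpq : r + N * q = p := Polynomial.modByMonic_add_div p N
  have hqd : q.natDegree = 1 := by
    rw [hq, Polynomial.natDegree_divByMonic _ hNm, hp, hNd]; omega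
  have hrd : r.degree < N.degree := Polynomial.degree_modByMonic_lt _ hNm
  have hql : q.coeff 1 = A := by
    have : q.leadingCoeff = A := by
      apply Polynomial.leadingCoeff_divByMonic_of_monic hNm
      rw [Polynomial.degree_eq_natDegree hNm.ne_zero, Polynomial.degree_eq_natDegree hp0, hp, hNd]
      exact_mod_cast Nat.le_succ m
    rw [← this, Polynomial.leadingCoeff, hqd]
  have hqe : q = Polynomial.C A * Polynomial.X + Polynomial.C (q.coeff 0) := by
    conv_lhs => rw [Polynomial.eq_X_add_C_of_natDegree_le_one hqd.le, hql]
  have hmem : ∀ x ∈ s, p.derivative.eval x = 0 := by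
    intro x hx
    simpa [hsdef, hp'0] using hx
  have hNx : ∀ x ∈ s, N.eval x = 0 := fun x hx => Lagrange.eval_nodal_at_node (v := id) hx
  -- complex side
  set v : ℝ → ℂ := fun x => (x : ℂ) with hv
  have hNC : N.map (algebraMap ℝ ℂ) = Lagrange.nodal s v := by
    rw [hN, Lagrange.nodal_eq, Lagrange.nodal_eq, Polynomial.map_prod]
    simp [hv]
  have evr : ∀ (f : Polynomial ℝ) (x : ℝ), (f.map (algebraMap ℝ ℂ)).eval (v x) = ((f.eval x : ℝ) : ℂ) := by
    intro f x
    rw [hv, Polynomial.eval_map_algebraMap]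
    exact Polynomial.aeval_algebraMap_apply_eq_algebraMap_eval x f
  have hrC : r.map (algebraMap ℝ ℂ) = Lagrange.interpolate s v (fun x => ((p.eval x : ℝ) : ℂ)) := by
    apply Lagrange.eq_interpolate_of_eval_eq
    · intro x _ y _ hxy; exact Complex.ofReal_injective hxy
    · rw [Polynomial.degree_map]
      rwa [hN, Lagrange.degree_nodal] at hrd
    · intro x hx
      rw [evr, ← hpq, Polynomial.eval_add, Polynomial.eval_mul, hNx x hx, zero_mul, add_zero]
  have hzx : ∀ x ∈ s, z ≠ v x := by
    rintro x hx rfl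
    exact him (Complex.ofReal_im x)
  have hNz : (Lagrange.nodal s v).eval z ≠ 0 := by
    rw [Lagrange.eval_nodal, Finset.prod_ne_zero_iff]
    intro x hx; exact sub_ne_zero.2 (hzx x hx)
  rw [← hpq, Polynomial.map_add, Polynomial.map_mul, hNC, hrC, Polynomial.eval_add,
    Polynomial.eval_mul, Lagrange.eval_interpolate_not_at_node _ hzx, ← mul_add] at hz
  have hz2 := (mul_eq_zero.1 hz).resolve_left hNz
  have hw : ∀ x ∈ s, Lagrange.nodalWeight s v x * (z - v x)⁻¹ * ((p.eval x : ℝ) : ℂ) =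
      ((A * (m+1) * (p.eval x / p.derivative.derivative.eval x) : ℝ) : ℂ) * (z - v x)⁻¹ := by
    intro x hx
    rw [Lagrange.nodalWeight_eq_eval_derivative_nodal hx, ← hNC, Polynomial.derivative_map, evr]
    have h2 : p.derivative.derivative.eval x = A * (m+1) * N.derivative.eval x := by
      rw [hd, Polynomial.derivative_C_mul, Polynomial.eval_mul, Polynomial.eval_C]
    have h3 : p.derivative.derivative.eval x ≠ 0 := by
      intro h0; have := h x (hmem x hx); rw [h0] at this; simp at this
    rw [h2] at h3 ⊢
    have h4 : A * (m+1) ≠ 0 := fun h0 => h3 (by rw [h0, zero_mul])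
    have h5 : N.derivative.eval x ≠ 0 := fun h0 => h3 (by rw [h0, mul_zero])
    have h6 : (A * (m+1) * (p.eval x / (A * (m+1) * N.derivative.eval x))) = p.eval x / N.derivative.eval x := by
      field_simp
    rw [h6]
    push_cast
    rw [div_eq_mul_inv]; ring
  rw [Finset.sum_congr rfl hw, hqe] at hz2
  have him2 := congrArg Complex.im hz2
  simp only [Polynomial.map_add, Polynomial.map_mul, Polynomial.map_C, Polynomial.map_X,
    Polynomial.eval_add, Polynomial.eval_mul, Polynomial.eval_C, Polynomial.eval_X, Complex.add_im,
    Complex.im_sum, Complex.zero_im] at him2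
  have i1 : ∀ x : ℝ, ((z - v x)⁻¹).im = - z.im / Complex.normSq (z - v x) := by
    intro x; rw [Complex.inv_im]; simp [hv]
  have i2 : ∀ (a : ℝ) (w : ℂ), ((a : ℂ) * w).im = a * w.im := fun a w => by simp
  have i3 : ∀ (a : ℝ), ((algebraMap ℝ ℂ) a) = (a : ℂ) := fun _ => rfl
  simp only [i1, i2, i3, Complex.ofReal_im] at him2
  have hfac : A * z.im * (1 + ∑ x ∈ s, (m+1) * (-(p.eval x / p.derivative.derivative.eval x)) *
      (1 / Complex.normSq (z - v x))) = 0 := by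
    rw [← him2, mul_add, Finset.mul_sum, mul_one, add_comm, add_zero]
    congr 1
    refine Finset.sum_congr rfl fun x _ => ?_
    ring
  have hpos : 0 < 1 + ∑ x ∈ s, (m+1) * (-(p.eval x / p.derivative.derivative.eval x)) *
      (1 / Complex.normSq (z - v x)) := by
    refine add_pos_of_pos_of_nonneg one_pos (Finset.sum_nonneg fun x hx => ?_)
    have h1 := h x (hmem x hx)
    have h2 : p.eval x / p.derivative.derivative.eval x ≤ 0 := by
      rcases mul_neg_iff.1 h1 with ⟨h1, h2⟩ | ⟨h1, h2⟩
      · exact (div_neg_of_pos_of_neg h1 h2).le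
      · exact (div_neg_of_neg_of_pos h1 h2).le
    have h3 := Complex.normSq_nonneg (z - v x)
    have h4 : (0:ℝ) ≤ m + 1 := by positivity
    exact mul_nonneg (mul_nonneg h4 (by linarith)) (by positivity)
  exact mul_ne_zero (mul_ne_zero hA0 him) hpos.ne' hfac

lemma critK (p : Polynomial ℝ) (m : ℕ) (hp : p.natDegree = m+1)
    (hs : p.derivative.roots.toFinset.card = m)
    (h : ∀ x, p.derivative.eval x = 0 → p.eval x * p.derivative.derivative.eval x < 0) :
    p.roots.toFinset.card = m+1 := by
  have hp0 : p ≠ 0 := by rintro rfl; simp at hp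
  set P := p.map (algebraMap ℝ ℂ) with hP
  have hP0 : P ≠ 0 := by rw [hP]; simpa using hp0
  have hPd : P.natDegree = m + 1 := by rw [hP, Polynomial.natDegree_map, hp]
  have him := critK_im p m hp hs h
  have evr : ∀ (f : Polynomial ℝ) (x : ℝ), (f.map (algebraMap ℝ ℂ)).eval (x : ℂ) = ((f.eval x : ℝ) : ℂ) := by
    intro f x
    rw [Polynomial.eval_map_algebraMap]
    exact Polynomial.aeval_algebraMap_apply_eq_algebraMap_eval x f
  have hre : ∀ z, P.eval z = 0 → z = (z.re : ℂ) ∧ p.eval z.re = 0 := by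
    intro z hz
    have h1 : z = (z.re : ℂ) := by
      apply Complex.ext <;> simp [him z hz]
    refine ⟨h1, ?_⟩
    rw [h1, hP, evr] at hz
    exact_mod_cast hz
  have hnd : P.roots.Nodup := by
    rw [Multiset.nodup_iff_count_le_one]
    intro z
    rw [Polynomial.count_roots]
    by_contra hcon
    push Not at hcon
    obtain ⟨h1, h2⟩ := (Polynomial.one_lt_rootMultiplicity_iff_isRoot hP0).1 hcon
    obtain ⟨h3, h4⟩ := hre z h1
    rw [Polynomial.IsRoot, hP, Polynomial.derivative_map, h3, evr] at h2
    have h5 := h _ (by exact_mod_cast h2)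
    rw [h4] at h5; simp at h5
  have hcard : P.roots.toFinset.card = m + 1 := by
    rw [Multiset.toFinset_card_of_nodup hnd, ← hPd]
    exact Polynomial.splits_iff_card_roots.1 (IsAlgClosed.splits P)
  apply le_antisymm
  · exact (Multiset.toFinset_card_le _).trans ((Polynomial.card_roots' p).trans hp.le)
  · rw [← hcard]
    refine Finset.card_le_card_of_injOn Complex.re ?_ ?_
    · intro z hz
      have : P.eval z = 0 := by simpa [hP0] using hz
      simpa [hp0] using (hre z this).2
    · intro z hz w hw hzw
      have h1 : P.eval z = 0 := by simpa [hP0] using hz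
      have h2 : P.eval w = 0 := by simpa [hP0] using hw
      rw [(hre z h1).1, (hre w h2).1, hzw]

lemma roots_of_crit (m : ℕ) : ∀ p : Polynomial ℝ, p.natDegree = m →
    (∀ j, j + 2 ≤ m → ∀ x, (Polynomial.derivative^[j+1] p).eval x = 0 →
      (Polynomial.derivative^[j] p).eval x * (Polynomial.derivative^[j+2] p).eval x < 0) →
    p.roots.toFinset.card = m := by
  induction m with
  | zero =>
    intro p hp _
    have := (Multiset.toFinset_card_le _).trans ((Polynomial.card_roots' p).trans hp.le)
    omega
  | succ m ih =>
    intro p hp h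
    have hd : p.derivative.natDegree = m := by
      rw [Polynomial.natDegree_derivative, hp]; rfl
    apply critK p m hp
    · apply ih _ hd
      intro j hj x hx
      exact h (j+1) (by omega) x hx
    · intro x hx
      rcases Nat.eq_zero_or_pos m with rfl | hm
      · exfalso
        have h1 := Polynomial.eq_C_of_natDegree_eq_zero hd
        rw [h1] at hx
        simp only [Polynomial.eval_C, Polynomial.coeff_derivative] at hx
        have h2 : p.coeff 1 ≠ 0 := by
          have : p.leadingCoeff ≠ 0 := by
            rw [Ne, Polynomial.leadingCoeff_eq_zero]; rintro rfl; simp at hp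
          rwa [Polynomial.leadingCoeff, hp] at this
        apply h2; simpa using hx
      · exact h 0 (by omega) x hx


/-- Dehomogenized polynomial. -/
def QQ (m : ℕ) (b : Fin (m+1) → ℝ) : Polynomial ℝ :=
  ∑ i : Fin (m+1), Polynomial.C (b i) * Polynomial.X ^ (m - (i:ℕ))

/-- unnormalize coordinates -/
def unc {K : Type} [CommSemiring K] (d : ℕ) (c : Fin (d+1) → K) : Fin (d+1) → K :=
  fun i => (d.choose i : K) * c i

lemma QQ_eval (m : ℕ) (b) (x : ℝ) : (QQ m b).eval x = fe m b x 1 := by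
  simp [QQ, fe, Polynomial.eval_finsetSum]

lemma QQ_natDegree (m : ℕ) (b : Fin (m+1) → ℝ) (h : b 0 ≠ 0) : (QQ m b).natDegree = m := by
  apply Polynomial.natDegree_eq_of_le_of_coeff_ne_zero
  · refine Polynomial.natDegree_sum_le_of_forall_le _ _ fun i _ => ?_
    refine (Polynomial.natDegree_C_mul_X_pow_le _ _).trans (Nat.sub_le _ _)
  · rw [QQ, Polynomial.finsetSum_coeff, Fin.sum_univ_succ]
    rw [Finset.sum_eq_zero]
    · simpa using h
    · intro i _
      rw [Polynomial.coeff_C_mul_X_pow, if_neg]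
      simp only [Fin.val_succ]; omega

lemma QQ_drop (m : ℕ) (b : Fin (m+2) → ℝ) (h : b 0 = 0) : QQ (m+1) b = QQ m (fun i => b i.succ) := by
  rw [QQ, Fin.sum_univ_succ, h]
  simp [QQ]

lemma QQ_derivative (d : ℕ) (c : Fin (d+2) → ℝ) :
    Polynomial.derivative (QQ (d+1) (unc (d+1) c)) =
      Polynomial.C ((d:ℝ)+1) * QQ d (unc d (DD d 1 0 c)) := by
  rw [QQ, Fin.sum_univ_castSucc, QQ, Polynomial.derivative_add, Polynomial.derivative_sum, Finset.mul_sum]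
  simp only [Fin.val_last, Nat.sub_self, pow_zero, mul_one, Polynomial.derivative_C, add_zero]
  refine Finset.sum_congr rfl fun i _ => ?_
  rw [Polynomial.derivative_C_mul_X_pow, ← mul_assoc, ← Polynomial.C_mul]
  congr 2
  · simp only [unc, DD_apply, Fin.val_castSucc, one_mul, zero_mul, add_zero]
    have h1 := Nat.choose_mul_succ_eq d (i:ℕ)
    have h2 : ((d.choose i : ℝ)) * (d + 1) = ((d+1).choose i : ℝ) * ((d + 1 - (i:ℕ) : ℕ) : ℝ) := by
      exact_mod_cast h1
    linear_combination - c i.castSucc * h2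
  · simp only [Fin.val_castSucc]; omega

lemma fe_unc_DD {d : ℕ} (c : Fin (d+2) → ℝ) (x : ℝ) :
    fe (d+1) (unc (d+1) c) x 1 = fe d (unc d (DD d x 1 c)) x 1 := by
  simp only [fe, unc, DD_apply, one_pow, mul_one]
  have hR : ∑ i : Fin (d+1), (d.choose i : ℝ) * (x * c i.castSucc + 1 * c i.succ) * x ^ (d - (i:ℕ)) =
      ∑ i : Fin (d+1), (d.choose i : ℝ) * c i.castSucc * x ^ (d + 1 - (i:ℕ)) +
      ∑ i : Fin (d+1), (d.choose i : ℝ) * c i.succ * x ^ (d - (i:ℕ)) := by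
    rw [← Finset.sum_add_distrib]
    refine Finset.sum_congr rfl fun i _ => ?_
    rw [show d + 1 - (i:ℕ) = (d - i) + 1 by omega, pow_succ]; ring
  have hR2 : ∑ i : Fin (d+1), (d.choose i : ℝ) * c i.castSucc * x ^ (d + 1 - (i:ℕ)) =
      ∑ i : Fin (d+2), (d.choose i : ℝ) * c i * x ^ (d + 1 - (i:ℕ)) := by
    rw [Fin.sum_univ_castSucc (n := d+1)]
    simp
  have hR3 := Fin.sum_univ_succ (n := d+1) (fun i : Fin (d+2) => (d.choose i : ℝ) * c i * x ^ (d + 1 - (i:ℕ)))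
  rw [hR, hR2, hR3, Fin.sum_univ_succ, add_assoc (G := ℝ), ← Finset.sum_add_distrib]
  congr 1
  · simp
  · refine Finset.sum_congr rfl fun i _ => ?_
    simp only [Fin.val_succ, Nat.choose_succ_succ, Nat.add_sub_add_right]
    push_cast; ring

lemma DD_comm (d : ℕ) (s t s' t' : ℝ) (c : Fin (d+3) → ℝ) :
    DD d s t (DD (d+1) s' t' c) = DD d s' t' (DD (d+1) s t c) := by
  funext i
  simp only [DD_apply, Fin.succ_castSucc]
  ring

lemma AH_triple (n : ℕ) (c : Fin (n+3) → ℝ) (h : AH n c) (x : ℝ) :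
    fe (n+2) (unc (n+2) c) x 1 * fe n (unc n (DD n 1 0 (DD (n+1) 1 0 c))) x 1 <
      fe (n+1) (unc (n+1) (DD (n+1) 1 0 c)) x 1 ^ 2 := by
  induction n with
  | zero =>
    have h : c 0 * c 2 < c 1 ^ 2 := h
    have e1 : (Fin.castSucc (1 : Fin 2) : Fin 3) = 1 := rfl
    have e2 : (Fin.succ (1 : Fin 2) : Fin 3) = 2 := rfl
    simp [fe, unc, DD_apply, Fin.sum_univ_succ]
    have e3 : (Fin.succ (0 : Fin 2) : Fin 3) = 1 := rfl
    nlinarith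
  | succ n ih =>
    have e1 := fe_unc_DD (d := n+2) c x
    have e2 := fe_unc_DD (d := n+1) (DD (n+2) 1 0 c) x
    have e3 := fe_unc_DD (d := n) (DD (n+1) 1 0 (DD (n+2) 1 0 c)) x
    rw [DD_comm (n+1)] at e2
    rw [DD_comm n x 1, DD_comm (n+1) x 1] at e3
    have := ih _ (h x 1 (by simp))
    rw [← e1, ← e2, ← e3] at this
    exact this

lemma AH_crit (n : ℕ) (c : Fin (n+3) → ℝ) (h : AH n c) (j : ℕ) (hj : j ≤ n) (x : ℝ)
    (hx : (Polynomial.derivative^[j+1] (QQ (n+2) (unc (n+2) c))).eval x = 0) :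
    (Polynomial.derivative^[j] (QQ (n+2) (unc (n+2) c))).eval x *
      (Polynomial.derivative^[j+2] (QQ (n+2) (unc (n+2) c))).eval x < 0 := by
  induction j generalizing n with
  | zero =>
    simp only [Function.iterate_succ, Function.iterate_zero, Function.comp, id] at hx ⊢
    rw [QQ_derivative] at hx ⊢
    rw [Polynomial.derivative_C_mul, QQ_derivative]
    simp only [Polynomial.eval_mul, Polynomial.eval_C, QQ_eval] at hx ⊢
    have h3 := AH_triple n c h x
    have h1 : (0:ℝ) < ((n+1:ℕ):ℝ) + 1 := by positivity
    have h2 : (0:ℝ) < (n:ℝ) + 1 := by positivity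
    have h4 := (mul_eq_zero.1 hx).resolve_left h1.ne'
    rw [h4] at h3
    have := mul_pos h1 h2
    nlinarith
  | succ j ih =>
    obtain ⟨n, rfl⟩ : ∃ m, n = m + 1 := ⟨n - 1, by omega⟩
    rw [Function.iterate_succ_apply _ (j+1)] at hx
    rw [Function.iterate_succ_apply _ j, Function.iterate_succ_apply _ (j+2)]
    rw [QQ_derivative, Polynomial.iterate_derivative_C_mul, Polynomial.eval_mul, Polynomial.eval_C] at *
    rw [Polynomial.iterate_derivative_C_mul, Polynomial.eval_mul, Polynomial.eval_C]
    have h1 : (0:ℝ) < ((n+2:ℕ):ℝ) + 1 := by positivity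
    have h4 := (mul_eq_zero.1 hx).resolve_left h1.ne'
    have := ih n _ (h 1 0 (by simp)) (by omega) h4
    have := mul_neg_of_pos_of_neg (mul_pos h1 h1) this
    linarith

lemma AH_lead (n : ℕ) (c : Fin (n+3) → ℝ) (h : AH n c) : c 0 * c 2 < c 1 ^ 2 := by
  induction n with
  | zero => exact h
  | succ n ih =>
    have := ih _ (h 1 0 (by simp))
    simp only [DD_apply, one_mul, zero_mul, add_zero] at this
    exact this

lemma hyp_of_AH (n : ℕ) (c : Fin (n+3) → ℝ) (h : AH n c) : unc (n+2) c ∈ HypSet (n+2) := by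
  have hl := AH_lead n c h
  have hc1 : c 0 = 0 → c 1 ≠ 0 := by
    intro h0 h1; rw [h0, h1] at hl; simp at hl
  have hane : unc (n+2) c ≠ 0 := by
    intro h0
    have q0 := congrFun h0 0
    have q1 := congrFun h0 1
    simp [unc] at q0 q1
    rcases q1 with q1 | q1
    · have : (0:ℝ) < (n:ℝ) + 2 := by positivity
      exact this.ne' q1
    · exact hc1 q0 q1
  set p := QQ (n+2) (unc (n+2) c) with hp
  by_cases h0 : c 0 = 0
  · have hb : unc (n+2) c 0 = 0 := by simp [unc, h0]
    have hd : p.natDegree = n + 1 := by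
      rw [hp, QQ_drop _ _ hb]
      apply QQ_natDegree
      simp only [unc, Fin.succ_zero_eq_one]
      apply mul_ne_zero _ (hc1 h0)
      simp
      positivity
    have hr := roots_of_crit (n+1) p hd (fun j hj x hx => AH_crit n c h j (by omega) x hx)
    obtain ⟨f, hf, hfS⟩ := exists_inj_of_card _ hr.ge
    have hp0 : p ≠ 0 := by rintro h0; rw [h0] at hd; simp at hd
    have hz : ∀ i, fe (n+2) (unc (n+2) c) (f i) 1 = 0 := by
      intro i
      rw [← QQ_eval]
      have := hfS i
      rw [Multiset.mem_toFinset, Polynomial.mem_roots hp0] at this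
      exact this
    refine mem_HypSet_of_zeros hane (Fin.cons 1 f) (Fin.cons 0 (fun _ => 1)) ?_ ?_ ?_
    · intro i; refine Fin.cases ?_ (fun i => ?_) i <;> simp
    · intro i j
      refine Fin.cases ?_ (fun i => ?_) i <;> refine Fin.cases ?_ (fun j => ?_) j <;> simp
      intro hij hfij; exact hij (hf hfij)
    · intro i; refine Fin.cases ?_ (fun i => ?_) i
      · simp only [Fin.cons_zero]
        rw [fe, Finset.sum_eq_zero]
        intro i _
        refine Fin.cases ?_ (fun i => ?_) i
        · simp [hb]
        · simp
      · simpa using hz i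
  · have hb : unc (n+2) c 0 ≠ 0 := by simp [unc, h0]
    have hd : p.natDegree = n + 2 := QQ_natDegree _ _ hb
    have hr := roots_of_crit (n+2) p hd (fun j hj x hx => AH_crit n c h j (by omega) x hx)
    obtain ⟨f, hf, hfS⟩ := exists_inj_of_card _ hr.ge
    have hp0 : p ≠ 0 := by rintro h0; rw [h0] at hd; simp at hd
    refine mem_HypSet_of_zeros hane f (fun _ => 1) ?_ ?_ ?_
    · intro i; simp
    · intro i j hij h; apply hij; apply hf; simpa using h
    · intro i
      rw [← QQ_eval]
      have := hfS i
      rw [Multiset.mem_toFinset, Polynomial.mem_roots hp0] at this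
      exact this


/-- normalized coordinates -/
def scn {K : Type} [Field K] (d : ℕ) (a : Fin (d+1) → K) : Fin (d+1) → K :=
  fun i => a i / (d.choose i : K)

lemma choose_cast_ne {K : Type} [Field K] [CharZero K] {d : ℕ} (i : Fin (d+1)) :
    (d.choose i : K) ≠ 0 := by
  have : d.choose i ≠ 0 := (Nat.choose_pos (by omega)).ne'
  exact_mod_cast this

lemma unc_scn {K : Type} [Field K] [CharZero K] (d : ℕ) (a : Fin (d+1) → K) : unc d (scn d a) = a := by
  funext i
  have := choose_cast_ne (K := K) i
  simp only [unc, scn]; field_simp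

lemma scn_unc {K : Type} [Field K] [CharZero K] (d : ℕ) (a : Fin (d+1) → K) : scn d (unc d a) = a := by
  funext i
  have := choose_cast_ne (K := K) i
  simp only [unc, scn]; field_simp

lemma continuous_unc (d : ℕ) : Continuous (unc d : (Fin (d+1) → ℝ) → _) := by
  unfold unc; fun_prop

lemma continuous_scn (d : ℕ) : Continuous (scn d : (Fin (d+1) → ℝ) → _) := by
  unfold scn; fun_prop

lemma hyp_of_open (n : ℕ) (U : Set (Fin (n+4) → ℝ)) (hU : IsOpen U)
    (h : ∀ a ∈ U, ¬ ∃ α u v : Fin (n+2) → ℝ, binForm (n+3) a = ∑ i, α i • (linForm (u i) (v i)) ^ (n+3)) :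
    ∀ a ∈ U, AH (n+1) (scn (n+3) a) := by
  intro a ha
  apply AH_of_SP
  refine mem_interior.2 ⟨unc (n+3) ⁻¹' U, ?_, hU.preimage (continuous_unc _), by simpa [unc_scn] using ha⟩
  rintro c hc ⟨α, u, v, hs⟩
  apply h _ hc
  refine ⟨α, u, v, ?_⟩
  rw [binForm_powsum]
  congr 1
  funext i
  simp only [unc, hs i, Finset.mul_sum]
  refine Finset.sum_congr rfl fun j _ => ?_
  ring

lemma hyp_iff_AH (n : ℕ) (a : Fin (n+4) → ℝ) : a ∈ HypSet (n+3) ↔ AH (n+1) (scn (n+3) a) := by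
  constructor
  · intro ha
    refine hyp_of_open n _ (isOpen_HypSet _) ?_ a ha
    rintro a ha ⟨α, u, v, h⟩
    exact hyp_not_powsum (by omega) ha α u v h
  · intro h
    have := hyp_of_AH _ _ h
    rwa [unc_scn] at this

lemma Rdr_sub (n : ℕ) : Rdr (n+3) (n+3) ⊆ HypSet (n+3) := by
  intro a ha
  rw [hyp_iff_AH]
  refine hyp_of_open n _ isOpen_interior ?_ a ha
  rintro a ha h
  have ha2 : a ∈ realRankSet (n+3) (n+3) := interior_subset ha
  have ha : waringRank (n+3) (binForm (n+3) a) = n+3 := ha2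
  have := Nat.sInf_le (s := {r | ∃ (α u v : Fin r → ℝ), binForm (n+3) a = ∑ i, α i • (linForm (u i) (v i)) ^ (n+3)}) h
  unfold waringRank at ha
  omega

lemma Rdr_sub_one : Rdr 1 1 ⊆ HypSet 1 := by
  intro a ha
  have ha2 : a ∈ realRankSet 1 1 := interior_subset ha
  have ha : waringRank 1 (binForm 1 a) = 1 := ha2
  have h0 : a 0 ≠ 0 ∨ a 1 ≠ 0 := by
    by_contra hcon
    push Not at hcon
    have hz : a = 0 := by
      funext i; fin_cases i
      · exact hcon.1
      · exact hcon.2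
    have : waringRank 1 (binForm 1 a) ≤ 0 := by
      apply Nat.sInf_le
      refine ⟨Fin.elim0, Fin.elim0, Fin.elim0, ?_⟩
      rw [hz, binForm_zero]; simp
    omega
  refine ⟨1, one_ne_zero, fun _ => a 0, fun _ => a 1, fun _ => h0, ?_, ?_⟩
  · intro i j hij; exact absurd (Subsingleton.elim i j) hij
  · simp [binForm, linForm]

lemma Rdr_eq {d : ℕ} (hd : Odd d) : Rdr d d = HypSet d := by
  apply Set.Subset.antisymm _ (hyp_subset_Rdr hd)
  obtain ⟨m, rfl⟩ := hd
  rcases m with _ | m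
  · exact Rdr_sub_one
  · exact Rdr_sub (2*m)

lemma topBoundary_eq (n : ℕ) (hd : Odd (n+3)) :
    topBoundary (n+3) (n+3) = closure (HypSet (n+3)) \ HypSet (n+3) := by
  rw [topBoundary, Rdr_eq hd]
  congr 1
  apply Set.Subset.antisymm
  · intro a ha
    rw [hyp_iff_AH]
    apply AH_of_interior
    refine mem_interior.2 ⟨unc (n+3) ⁻¹' (interior (closure (HypSet (n+3)))), ?_,
      isOpen_interior.preimage (continuous_unc _), by simpa [unc_scn] using ha⟩
    intro c hc
    have hc : unc (n+3) c ∈ closure (HypSet (n+3)) := interior_subset hc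
    have hcl : IsClosed {a : Fin (n+4) → ℝ | AHw (n+1) (scn (n+3) a)} :=
      (AHw_closed (n+1)).preimage (continuous_scn (n+3))
    have hsub : HypSet (n+3) ⊆ {a : Fin (n+4) → ℝ | AHw (n+1) (scn (n+3) a)} := by
      intro a ha
      exact AHw_of_AH _ _ ((hyp_iff_AH n a).1 ha)
    have := closure_minimal hsub hcl hc
    simpa [scn_unc] using this
  · exact interior_maximal subset_closure (isOpen_HypSet _)


/-- Coefficients of a product of linear forms. -/
def prodC {K : Type} [CommSemiring K] : (n : ℕ) → (A B : Fin n → K) → Fin (n+1) → K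
  | 0, _, _ => fun _ => 1
  | n+1, A, B => mulLin n (A 0) (B 0) (prodC n (fun i => A i.succ) (fun i => B i.succ))

lemma binForm_prodC {K : Type} [CommSemiring K] (n : ℕ) (A B : Fin n → K) :
    binForm n (prodC n A B) = ∏ i, linForm (A i) (B i) := by
  induction n with
  | zero => simp [binForm, prodC]
  | succ n ih => rw [prodC, binForm_mulLin, ih, Fin.prod_univ_succ]

lemma mulLin_map {K L : Type} [CommSemiring K] [CommSemiring L] (f : K →+* L) (n : ℕ) (u v : K)
    (b : Fin (n+1) → K) (i) : f (mulLin n u v b i) = mulLin n (f u) (f v) (fun i => f (b i)) i := by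
  simp only [mulLin, map_add, map_mul]
  congr 2
  · refine Fin.lastCases ?_ (fun i => ?_) i <;> simp
  · refine Fin.cases ?_ (fun i => ?_) i <;> simp

lemma prodC_map {K L : Type} [CommSemiring K] [CommSemiring L] (f : K →+* L) (n : ℕ) (A B : Fin n → K)
    (i) : f (prodC n A B i) = prodC n (fun i => f (A i)) (fun i => f (B i)) i := by
  induction n with
  | zero => simp [prodC]
  | succ n ih =>
    simp only [prodC, mulLin_map]
    congr 1
    funext i
    exact ih _ _ _

lemma continuous_mulLin {T : Type} [TopologicalSpace T] (n : ℕ) (u v : T → ℝ) (b : T → Fin (n+1) → ℝ)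
    (hu : Continuous u) (hv : Continuous v) (hb : Continuous b) :
    Continuous fun t => mulLin n (u t) (v t) (b t) := by
  refine continuous_pi fun i => ?_
  simp only [mulLin]
  refine (hu.mul ?_).add (hv.mul ?_)
  · refine Fin.lastCases ?_ (fun i => ?_) i
    · simpa using continuous_const
    · simp only [Fin.snoc_castSucc]
      exact (continuous_apply i).comp hb
  · refine Fin.cases ?_ (fun i => ?_) i
    · simpa using continuous_const
    · simp only [Fin.cons_succ]
      exact (continuous_apply i).comp hb

lemma continuous_prodC {T : Type} [TopologicalSpace T] (n : ℕ) (A B : T → Fin n → ℝ)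
    (hA : Continuous A) (hB : Continuous B) : Continuous fun t => prodC n (A t) (B t) := by
  induction n with
  | zero => simp only [prodC]; exact continuous_const
  | succ n ih =>
    simp only [prodC]
    apply continuous_mulLin
    · fun_prop
    · fun_prop
    · exact ih _ _ (by fun_prop) (by fun_prop)

lemma prodC_ne_zero (n : ℕ) (A B : Fin n → ℝ) (h : ∀ i, A i ≠ 0 ∨ B i ≠ 0) : prodC n A B ≠ 0 := by
  intro h0
  have := binForm_prodC n A B
  rw [h0, binForm_zero] at this
  exact (Finset.prod_ne_zero_iff.2 fun i (_ : i ∈ Finset.univ) => linForm_ne_zero (h i)) this.symm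

/-- unit parameters -/
def unitPar (d : ℕ) : Set ((Fin d → ℝ) × (Fin d → ℝ)) := {w | ∀ i, w.1 i ^ 2 + w.2 i ^ 2 = 1}

lemma unitPar_ne {d : ℕ} {w} (hw : w ∈ unitPar d) (i) : w.1 i ≠ 0 ∨ w.2 i ≠ 0 := by
  by_contra hcon
  push Not at hcon
  have := hw i
  rw [hcon.1, hcon.2] at this; norm_num at this

lemma unitPar_compact (d : ℕ) : IsCompact (unitPar d) := by
  have hc : IsClosed (unitPar d) := by
    have : unitPar d = ⋂ i, {w | w.1 i ^ 2 + w.2 i ^ 2 = 1} := by ext; simp [unitPar]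
    rw [this]
    exact isClosed_iInter fun i => isClosed_eq (by fun_prop) (by fun_prop)
  refine IsCompact.of_isClosed_subset (isCompact_Icc (a := ((fun _ => -1, fun _ => -1) : (Fin d → ℝ) × (Fin d → ℝ)))
    (b := (fun _ => 1, fun _ => 1))) hc ?_
  intro w hw
  constructor
  · constructor <;> intro i
    · change -1 ≤ w.1 i
      nlinarith [hw i, sq_nonneg (w.2 i), sq_nonneg (w.1 i)]
    · change -1 ≤ w.2 i
      nlinarith [hw i, sq_nonneg (w.2 i), sq_nonneg (w.1 i)]
  · constructor <;> intro i
    · change w.1 i ≤ 1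
      nlinarith [hw i, sq_nonneg (w.2 i), sq_nonneg (w.1 i)]
    · change w.2 i ≤ 1
      nlinarith [hw i, sq_nonneg (w.2 i), sq_nonneg (w.1 i)]

lemma hyp_unit {d : ℕ} {a : Fin (d+1) → ℝ} (ha : a ∈ HypSet d) :
    ∃ t : ℝ, ∃ w ∈ unitPar d, a = t • prodC d w.1 w.2 := by
  obtain ⟨t, ht, A, B, h0, hi, hf⟩ := ha
  let r : Fin d → ℝ := fun i => Real.sqrt (A i ^ 2 + B i ^ 2)
  have hr2 : ∀ i, 0 < A i ^ 2 + B i ^ 2 := by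
    intro i
    rcases h0 i with h | h <;> positivity
  have hr : ∀ i, r i ≠ 0 := fun i => (Real.sqrt_pos.2 (hr2 i)).ne'
  refine ⟨t * ∏ i, r i, (fun i => A i / r i, fun i => B i / r i), ?_, ?_⟩
  · intro i
    have : r i ^ 2 = A i ^ 2 + B i ^ 2 := Real.sq_sqrt (hr2 i).le
    have := hr i
    simp only
    field_simp
    linarith
  · apply binForm_inj d
    rw [hf, binForm_smul, binForm_prodC, C_mul, mul_assoc, map_prod, ← Finset.prod_mul_distrib]
    congr 1
    refine Finset.prod_congr rfl fun i _ => ?_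
    simp only [linForm, mul_add, ← mul_assoc, ← C_mul]
    rw [mul_div_cancel₀ _ (hr i), mul_div_cancel₀ _ (hr i)]

lemma closure_hyp {d : ℕ} {a : Fin (d+1) → ℝ} (ha : a ∈ closure (HypSet d)) :
    ∃ (t : ℝ) (A B : Fin d → ℝ), (∀ i, A i ≠ 0 ∨ B i ≠ 0) ∧ a = t • prodC d A B := by
  let Φ : (Fin d → ℝ) × (Fin d → ℝ) → Fin (d+1) → ℝ := fun w => prodC d w.1 w.2
  have hΦ : Continuous Φ := continuous_prodC d _ _ continuous_fst continuous_snd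
  have hne : (unitPar d).Nonempty := ⟨(fun _ => 1, fun _ => 0), fun i => by simp⟩
  obtain ⟨w0, hw0, hmin⟩ := (unitPar_compact d).exists_isMinOn hne (f := fun w => ‖Φ w‖) (by fun_prop)
  have hm : 0 < ‖Φ w0‖ := norm_pos_iff.2 (prodC_ne_zero d _ _ (unitPar_ne hw0))
  set m := ‖Φ w0‖ with hmdef
  set M := (‖a‖ + 1) / m with hM
  set S := (fun q : ℝ × ((Fin d → ℝ) × (Fin d → ℝ)) => q.1 • Φ q.2) '' (Set.Icc (-M) M ×ˢ unitPar d) with hS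
  have hSc : IsClosed S := by
    apply IsCompact.isClosed
    apply (isCompact_Icc.prod (unitPar_compact d)).image
    fun_prop
  have hsub : Metric.ball a 1 ∩ HypSet d ⊆ S := by
    rintro b ⟨hb, hbH⟩
    obtain ⟨t, w, hw, hbt⟩ := hyp_unit hbH
    refine ⟨(t, w), ⟨?_, hw⟩, hbt.symm⟩
    apply abs_le.1
    change |t| ≤ M
    rw [hM, le_div_iff₀ hm]
    have h1 : ‖b‖ = |t| * ‖Φ w‖ := by rw [hbt, norm_smul, Real.norm_eq_abs]
    have h2 : m ≤ ‖Φ w‖ := hmin hw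
    have h3 : ‖b‖ ≤ ‖a‖ + 1 := by
      have h5 : b = a + (b - a) := by abel
      have := norm_add_le a (b - a)
      rw [← h5] at this
      have h4 : ‖b - a‖ < 1 := by simpa [dist_eq_norm] using hb
      linarith
    nlinarith [mul_le_mul_of_nonneg_left h2 (abs_nonneg t)]
  have h1 : a ∈ closure (Metric.ball a 1 ∩ HypSet d) :=
    Metric.isOpen_ball.inter_closure ⟨Metric.mem_ball_self one_pos, ha⟩
  obtain ⟨⟨t, w⟩, ⟨_, hw⟩, hq⟩ := closure_minimal hsub hSc h1
  exact ⟨t, w.1, w.2, unitPar_ne hw, hq.symm⟩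


/-- the form has a double linear factor -/
def HasDbl {K : Type} [Field K] (n : ℕ) (a : Fin (n+3) → K) : Prop :=
  ∃ u v : K, (u ≠ 0 ∨ v ≠ 0) ∧ ∃ b : Fin (n+1) → K, a = mulLin (n+1) u v (mulLin n u v b)

lemma fe_mulLin {K : Type} [Field K] (n : ℕ) (u v : K) (b : Fin (n+1) → K) (x y : K) :
    fe (n+1) (mulLin n u v b) x y = (u * x + v * y) * fe n b x y := by
  rw [← eval_binForm, binForm_mulLin, map_mul, eval_binForm, eval_linForm]

lemma div_mulLin {K : Type} [Field K] (n : ℕ) (a : Fin (n+2) → K) (x y : K)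
    (h0 : x ≠ 0 ∨ y ≠ 0) (h : fe (n+1) a x y = 0) :
    ∃ b : Fin (n+1) → K, a = mulLin n y (-x) b := by
  obtain ⟨b, hb⟩ := div_linForm n a x y h0 h
  exact ⟨b, binForm_inj _ (by rw [hb, binForm_mulLin])⟩

lemma dbl_of_closure {n : ℕ} {a : Fin (n+3) → ℝ} (ha : a ∈ closure (HypSet (n+2)))
    (hn : a ∉ HypSet (n+2)) (h0 : a ≠ 0) : HasDbl n a := by
  obtain ⟨t, A, B, hAB, haa⟩ := closure_hyp ha
  have ht : t ≠ 0 := by rintro rfl; simp at haa; exact h0 haa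
  have hf : binForm (n+2) a = C t * ∏ i, linForm (A i) (B i) := by
    rw [haa, binForm_smul, binForm_prodC]
  have : ∃ i j, i ≠ j ∧ A i * B j = A j * B i := by
    by_contra hcon
    push Not at hcon
    exact hn ⟨t, ht, A, B, hAB, hcon, hf⟩
  obtain ⟨i, j, hij, hd⟩ := this
  obtain ⟨j', rfl⟩ := Fin.exists_succAbove_eq hij.symm
  have hpt : B i ≠ 0 ∨ -A i ≠ 0 := by
    rcases hAB i with h | h
    · right; simpa using h
    · left; exact h
  have hfe : fe (n+2) a (B i) (-A i) = 0 := by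
    rw [fe_of_prod hf, Finset.prod_eq_zero (Finset.mem_univ i), mul_zero]
    ring
  obtain ⟨g, hg⟩ := div_mulLin (n+1) a (B i) (-A i) hpt hfe
  have hg2 : binForm (n+1) g = C (-t) * ∏ k, linForm (A (i.succAbove k)) (B (i.succAbove k)) := by
    have hl : linForm (-A i) (-B i) ≠ 0 := linForm_ne_zero (by simpa using hAB i)
    apply mul_left_cancel₀ hl
    rw [← binForm_mulLin, ← hg, hf, Fin.prod_univ_succAbove _ i]
    simp only [linForm, C_neg]
    ring
  have hfe2 : fe (n+1) g (B i) (-A i) = 0 := by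
    rw [fe_of_prod hg2, Finset.prod_eq_zero (Finset.mem_univ j'), mul_zero]
    linarith
  obtain ⟨b, hb⟩ := div_mulLin n g (B i) (-A i) hpt hfe2
  refine ⟨-A i, -B i, by simpa using hAB i, b, ?_⟩
  rw [hg, hb]

/-- eventually nonvanishing quadratics -/
lemma quad_ev (p q r : ℝ) (hr : r ≠ 0) :
    ∀ᶠ e in nhdsWithin (0:ℝ) {0}ᶜ, p + q * e + r * e ^ 2 ≠ 0 := by
  have hP : (Polynomial.C p + Polynomial.C q * Polynomial.X + Polynomial.C r * Polynomial.X ^ 2 :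
      Polynomial ℝ) ≠ 0 := by
    intro h
    have := congrArg (fun P => Polynomial.coeff P 2) h
    simp [Polynomial.coeff_X, Polynomial.coeff_C] at this
    exact hr this
  have hfin := Polynomial.finite_setOf_isRoot hP
  have h1 : ∀ᶠ e in nhdsWithin (0:ℝ) {0}ᶜ, e ∈ ({e | Polynomial.IsRoot (Polynomial.C p + Polynomial.C q * Polynomial.X + Polynomial.C r * Polynomial.X ^ 2 :
      Polynomial ℝ) e})ᶜ := by
    have hf2 := hfin.subset (Set.diff_subset (t := {0}))
    have := hf2.isClosed.isOpen_compl.mem_nhds (x := 0) (by simp)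
    filter_upwards [mem_nhdsWithin_of_mem_nhds this, self_mem_nhdsWithin] with e he he2 hcon
    exact he ⟨hcon, he2⟩
  filter_upwards [h1] with e he hcon
  apply he
  simp [Polynomial.IsRoot, hcon]

lemma prod_mem_closure (d : ℕ) (t : ℝ) (A B : Fin d → ℝ) : t • prodC d A B ∈ closure (HypSet d) := by
  let γ : ℝ → Fin (d+1) → ℝ := fun e =>
    (t + e) • prodC d (fun i => A i + e) (fun i => B i + e * (i : ℕ))
  have hγ : Continuous γ := by
    have := continuous_prodC d (fun e : ℝ => fun i => A i + e) (fun e : ℝ => fun i => B i + e * (i : ℕ))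
      (by fun_prop) (by fun_prop)
    fun_prop
  have h0 : γ 0 = t • prodC d A B := by simp [γ]
  rw [← h0]
  refine mem_closure_of_tendsto (b := nhdsWithin (0:ℝ) {0}ᶜ) (hγ.continuousAt.tendsto.mono_left nhdsWithin_le_nhds) ?_
  have e1 : ∀ᶠ e in nhdsWithin (0:ℝ) {0}ᶜ, ∀ i j : Fin d, i ≠ j →
      (A i + e) * (B j + e * (j : ℕ)) ≠ (A j + e) * (B i + e * (i : ℕ)) := by
    rw [Filter.eventually_all]; intro i
    rw [Filter.eventually_all]; intro j
    by_cases hij : i = j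
    · simp [hij]
    have hr : ((j : ℕ) : ℝ) - (i : ℕ) ≠ 0 := by
      rw [sub_ne_zero]
      intro h
      exact hij (Fin.ext (by exact_mod_cast h.symm))
    filter_upwards [quad_ev (A i * B j - A j * B i) (B j + A i * (j:ℕ) - B i - A j * (i : ℕ)) _ hr] with e he _ hcon
    apply he
    linear_combination hcon
  have e2 : ∀ᶠ e in nhdsWithin (0:ℝ) {0}ᶜ, ∀ i : Fin d, A i + e ≠ 0 := by
    rw [Filter.eventually_all]; intro i
    filter_upwards [quad_ev (A i ^2) (2 * A i) 1 one_ne_zero] with e he hcon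
    apply he
    linear_combination (A i + e) * hcon
  have e3 : ∀ᶠ e in nhdsWithin (0:ℝ) {0}ᶜ, t + e ≠ 0 := by
    filter_upwards [quad_ev (t ^2) (2 * t) 1 one_ne_zero] with e he hcon
    apply he
    linear_combination (t + e) * hcon
  filter_upwards [e1, e2, e3] with e h1 h2 h3
  refine ⟨t + e, h3, _, _, fun i => Or.inl (h2 i), h1, ?_⟩
  rw [binForm_smul, binForm_prodC]

lemma dbl_notMem (n : ℕ) (t u v : ℝ) (A B : Fin n → ℝ) :
    t • prodC (n+2) (Fin.cons u (Fin.cons u A)) (Fin.cons v (Fin.cons v B)) ∉ HypSet (n+2) := by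
  intro h
  have hne := ne_zero_of_mem_HypSet h
  obtain ⟨x, y, h0, hi, hz⟩ := zeros_of_mem_HypSet h
  set A' : Fin (n+2) → ℝ := Fin.cons u (Fin.cons u A) with hA'
  set B' : Fin (n+2) → ℝ := Fin.cons v (Fin.cons v B) with hB'
  have hf : binForm (n+2) (t • prodC (n+2) A' B') = C t * ∏ i, linForm (A' i) (B' i) := by
    rw [binForm_smul, binForm_prodC]
  have ht : t ≠ 0 := by rintro rfl; simp at hne
  have hA0 : ∀ i, A' i ≠ 0 ∨ B' i ≠ 0 := by
    intro i
    by_contra hcon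
    push Not at hcon
    apply hne
    apply binForm_eq_zero
    rw [hf, Finset.prod_eq_zero (Finset.mem_univ i), mul_zero]
    rw [hcon.1, hcon.2, linForm_eq_zero]
  have : ∀ i, ∃ k : Fin (n+1), A' k.succ * x i + B' k.succ * y i = 0 := by
    intro i
    have := hz i
    rw [fe_of_prod hf, mul_eq_zero, or_iff_right ht, Finset.prod_eq_zero_iff] at this
    obtain ⟨k, _, hk⟩ := this
    refine Fin.cases (fun hk => ?_) (fun k hk => ⟨k, hk⟩) k hk
    exact ⟨0, by simpa [hA', hB'] using hk⟩
  choose f hf' using this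
  obtain ⟨i, j, hij, he⟩ := Fintype.exists_ne_map_eq_of_card_lt f (by simp)
  apply hi i j hij
  have e1 := hf' i
  have e2 := hf' j
  rw [← he] at e2
  rcases hA0 (f i).succ with h | h
  · apply mul_left_cancel₀ h
    linear_combination y j * e1 - y i * e2
  · apply mul_left_cancel₀ h
    linear_combination x j * e1 * (-1) + x i * e2

lemma it_sum {ι : Type} (j : Fin 2) (k : ℕ) (s : Finset ι) (f : ι → MvPolynomial (Fin 2) ℂ) :
    (fun g => pderiv j g)^[k] (∑ i ∈ s, f i) = ∑ i ∈ s, (fun g => pderiv j g)^[k] (f i) := by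
  induction k with
  | zero => rfl
  | succ k ih => simp only [Function.iterate_succ_apply', ih, map_sum]

lemma it_one (k p q : ℕ) (c : ℂ) :
    (fun g => pderiv (1 : Fin 2) g)^[k] (C c * X 0 ^ p * X 1 ^ q)
      = C (c * q.descFactorial k) * X 0 ^ p * X 1 ^ (q - k) := by
  induction k with
  | zero => simp
  | succ k ih =>
    rw [Function.iterate_succ_apply', ih, Nat.descFactorial_succ]
    simp [Derivation.leibniz, pderiv_X, Nat.sub_sub]
    ring

lemma it_zero (k p q : ℕ) (c : ℂ) :
    (fun g => pderiv (0 : Fin 2) g)^[k] (C c * X 0 ^ p * X 1 ^ q)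
      = C (c * p.descFactorial k) * X 0 ^ (p - k) * X 1 ^ q := by
  induction k with
  | zero => simp
  | succ k ih =>
    rw [Function.iterate_succ_apply', ih, Nat.descFactorial_succ]
    simp [Derivation.leibniz, pderiv_X, Nat.sub_sub]
    ring

lemma apolarPair_eq (d : ℕ) (h a : Fin (d+1) → ℂ) :
    apolarPair d h a = ∑ i, h i * a i * ((d - (i:ℕ)).factorial * (i : ℕ).factorial : ℕ) := by
  unfold apolarPair diffOp
  rw [map_sum]
  refine Finset.sum_congr rfl fun i _ => ?_
  unfold binForm
  rw [it_sum, it_sum, smul_eval, map_sum, Finset.sum_eq_single i]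
  · rw [it_one, it_zero]
    simp [Nat.descFactorial_self]
    ring
  · intro j _ hj
    rw [it_one, it_zero]
    have hj' : (j : ℕ) ≠ i := fun h => hj (Fin.ext h)
    rcases lt_or_gt_of_ne hj' with h | h
    · simp [Nat.descFactorial_eq_zero_iff_lt.2 h]
    · have : (j : ℕ) - i ≠ 0 := by omega
      simp [this]
  · simp

/-- tangent vectors to the cone over the rational normal curve (normalized) -/
def tvn (d : ℕ) (u v α β : ℂ) (i : ℕ) : ℂ :=
  ((d - i : ℕ) : ℂ) * u ^ (d - i - 1) * α * v ^ i + u ^ (d - i) * ((i : ℂ) * v ^ (i - 1) * β)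

def tv (d : ℕ) (t u v α β : ℂ) : Fin (d+1) → ℂ := fun i => t * (d.choose i) * tvn d u v α β i

lemma tvn_deriv (d : ℕ) (u v α β : ℂ) (i : ℕ) :
    HasDerivAt (fun e : ℂ => (u + e * α) ^ (d - i) * (v + e * β) ^ i) (tvn d u v α β i) 0 := by
  have h1 : HasDerivAt (fun e : ℂ => u + e * α) α 0 := by
    simpa using ((hasDerivAt_id (0:ℂ)).mul_const α).const_add u
  have h2 : HasDerivAt (fun e : ℂ => v + e * β) β 0 := by
    simpa using ((hasDerivAt_id (0:ℂ)).mul_const β).const_add v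
  have := (h1.fun_pow (d - i)).fun_mul (h2.fun_pow i)
  simpa [tvn] using this

lemma fe_deriv (d : ℕ) (h : Fin (d+1) → ℂ) (u v α β : ℂ) :
    HasDerivAt (fun e : ℂ => fe d h (u + e * α) (v + e * β)) (∑ i : Fin (d+1), h i * tvn d u v α β i) 0 := by
  unfold fe
  have := HasDerivAt.fun_sum (u := Finset.univ) (x := (0:ℂ)) fun (i : Fin (d+1)) _ => (tvn_deriv d u v α β i).const_mul (h i)
  simpa [mul_assoc] using this

lemma apolarPair_tv (d : ℕ) (h : Fin (d+1) → ℂ) (t u v α β : ℂ) :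
    apolarPair d h (tv d t u v α β) = t * d.factorial * ∑ i : Fin (d+1), h i * tvn d u v α β i := by
  rw [apolarPair_eq, Finset.mul_sum]
  refine Finset.sum_congr rfl fun i _ => ?_
  have := Nat.choose_mul_factorial_mul_factorial (Nat.lt_succ_iff.1 i.2)
  rw [← this, tv]
  push_cast
  ring

lemma eval_chain {σ : Type} [Fintype σ] [DecidableEq σ] (p : MvPolynomial σ ℂ) (g : ℂ → σ → ℂ) (g' : σ → ℂ)
    (hg : ∀ i, HasDerivAt (fun e => g e i) (g' i) 0) :
    HasDerivAt (fun e => eval (g e) p) (∑ i, eval (g 0) (pderiv i p) * g' i) 0 := by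
  induction p using MvPolynomial.induction_on with
  | C a => simpa using hasDerivAt_const (0:ℂ) a
  | add p q hp hq =>
    simp only [map_add, add_mul, Finset.sum_add_distrib]
    exact hp.add hq
  | mul_X p j hp =>
    have := hp.fun_mul (hg j)
    simp only [map_mul, eval_X]
    refine this.congr_deriv ?_
    simp only [Derivation.leibniz, pderiv_X, smul_eq_mul, map_add, map_mul, add_mul, Finset.sum_add_distrib, eval_X]
    symm
    rw [Finset.sum_mul, add_comm]
    congr 1
    · exact Finset.sum_congr rfl fun i _ => by ring
    · rw [Finset.sum_eq_single j]
      · simp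
      · intro b _ hb
        simp [Pi.single_eq_of_ne (Ne.symm hb)]
      · simp

abbrev Scone (d : ℕ) : Set (Fin (d+1) → ℂ) := crlCone d 1 fun _ => d

lemma mem_Scone {d : ℕ} {a : Fin (d+1) → ℂ} : a ∈ Scone d ↔
    ∃ t u v : ℂ, a = fun i : Fin (d+1) => t * (d.choose i) * (u ^ (d - (i:ℕ)) * v ^ (i:ℕ)) := by
  have key : ∀ t u v : ℂ, C t * linForm u v ^ d =
      binForm d (fun i : Fin (d+1) => t * (d.choose i) * (u ^ (d - (i:ℕ)) * v ^ (i:ℕ))) := by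
    intro t u v
    rw [linForm_pow, ← binForm_smul]
    congr 1
    funext i
    simp only [Pi.smul_apply, smul_eq_mul]
    ring
  constructor
  · rintro ⟨t, u, v, h⟩
    refine ⟨t, u 0, v 0, binForm_inj d ?_⟩
    rw [h, ← key]; simp
  · rintro ⟨t, u, v, rfl⟩
    refine ⟨t, fun _ => u, fun _ => v, ?_⟩
    rw [← key]; simp

lemma tv_mem (d : ℕ) (t u v α β : ℂ) :
    tv d t u v α β ∈ zTangentAt (Scone d) (fun i : Fin (d+1) => t * (d.choose i) * (u ^ (d - (i:ℕ)) * v ^ (i:ℕ))) := by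
  intro p hp
  let g : ℂ → Fin (d+1) → ℂ := fun e i => t * (d.choose i) * ((u + e * α) ^ (d - (i:ℕ)) * (v + e * β) ^ (i:ℕ))
  have hg := eval_chain p g (tv d t u v α β) (fun i => (tvn_deriv d u v α β i).const_mul _)
  have h0 : (fun e => eval (g e) p) = fun _ => 0 := by
    funext e
    exact hp _ (mem_Scone.2 ⟨t, _, _, rfl⟩)
  rw [h0] at hg
  have := hg.unique (hasDerivAt_const (0:ℂ) (0:ℂ))
  simpa [g] using this

/-- `h` in the generating set has a double root -/
lemma dbl_of_E {n : ℕ} {h a : Fin (n+3) → ℂ} (ha : a ∈ Scone (n+2)) (ha0 : a ≠ 0)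
    (hT : ∀ v ∈ zTangentAt (Scone (n+2)) a, apolarPair (n+2) h v = 0) : HasDbl n h := by
  obtain ⟨t, u, v, rfl⟩ := mem_Scone.1 ha
  have ht : t ≠ 0 := by
    rintro rfl; apply ha0; funext i; simp
  have huv : u ≠ 0 ∨ v ≠ 0 := by
    by_contra hcon
    push Not at hcon
    apply ha0
    funext i
    rw [hcon.1, hcon.2]
    by_cases hi : (i : ℕ) = 0
    · simp [hi]
    · simp [hi]
  have hder : ∀ α β : ℂ, HasDerivAt (fun e : ℂ => fe (n+2) h (u + e * α) (v + e * β)) 0 0 := by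
    intro α β
    have h1 := hT _ (tv_mem (n+2) t u v α β)
    rw [apolarPair_tv] at h1
    have h2 : (t * ((n+2).factorial : ℂ)) ≠ 0 := mul_ne_zero ht (by exact_mod_cast Nat.factorial_ne_zero _)
    have h3 := (mul_eq_zero.1 h1).resolve_left h2
    have := fe_deriv (n+2) h u v α β
    rwa [h3] at this
  have hz : fe (n+2) h u v = 0 := by
    have h1 := hder u v
    have h2 : (fun e : ℂ => fe (n+2) h (u + e * u) (v + e * v)) = fun e => (1 + e) ^ (n+2) * fe (n+2) h u v := by
      funext e
      unfold fe
      rw [Finset.mul_sum]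
      refine Finset.sum_congr rfl fun i _ => ?_
      have e1 : u + e * u = (1 + e) * u := by ring
      have e2 : v + e * v = (1 + e) * v := by ring
      have e3 : (1 + e) ^ (n+2) = (1 + e) ^ (n + 2 - (i:ℕ)) * (1 + e) ^ (i : ℕ) := by
        rw [← pow_add]; congr 1; omega
      rw [e1, e2, mul_pow, mul_pow, e3]
      ring
    rw [h2] at h1
    have h3 : HasDerivAt (fun e : ℂ => (1 + e) ^ (n+2) * fe (n+2) h u v) ((n+2 : ℕ) * fe (n+2) h u v) 0 := by
      have h4 : HasDerivAt (fun e : ℂ => 1 + e) 1 0 := (hasDerivAt_id (0:ℂ)).const_add 1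
      simpa using (h4.fun_pow (n+2)).mul_const (fe (n+2) h u v)
    have h5 := h3.unique h1
    exact (mul_eq_zero.1 h5).resolve_left (by exact_mod_cast Nat.succ_ne_zero (n+1))
  obtain ⟨g, rfl⟩ := div_mulLin (n+1) h u v huv hz
  have hz2 : fe (n+1) g u v = 0 := by
    have key : ∀ α β : ℂ, v * α - u * β ≠ 0 → fe (n+1) g u v = 0 := by
      intro α β hne
      have h1 := hder α β
      have h2 : (fun e : ℂ => fe (n+2) (mulLin (n+1) v (-u) g) (u + e * α) (v + e * β)) =
          fun e => (e * (v * α - u * β)) * fe (n+1) g (u + e * α) (v + e * β) := by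
        funext e
        rw [fe_mulLin]; ring
      rw [h2] at h1
      have h3 := ((hasDerivAt_id (0:ℂ)).mul_const (v * α - u * β)).fun_mul (fe_deriv (n+1) g u v α β)
      have h4 := h3.unique h1
      simp at h4
      exact h4.resolve_left hne
    rcases huv with hu | hv
    · exact key 0 1 (by simpa using hu)
    · exact key 1 0 (by simpa using hv)
  obtain ⟨b, rfl⟩ := div_mulLin n g u v huv hz2
  exact ⟨v, -u, by simpa [or_comm] using huv, b, rfl⟩

/-- the tangent space as a submodule -/
def Tsub (d : ℕ) (a : Fin (d+1) → ℂ) : Submodule ℂ (Fin (d+1) → ℂ) where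
  carrier := zTangentAt (Scone d) a
  add_mem' := by
    intro x y hx hy p hp
    have h1 := hx p hp
    have h2 := hy p hp
    simp only [Pi.add_apply, mul_add, Finset.sum_add_distrib, h1, h2, add_zero]
  zero_mem' := by intro p _; simp
  smul_mem' := by
    intro c x hx p hp
    have h1 := hx p hp
    simp only [Pi.smul_apply, smul_eq_mul, mul_left_comm _ c, ← Finset.mul_sum, h1, mul_zero]

lemma diff_XX {d : ℕ} (a w : Fin (d+1) → ℂ) (p q r m : Fin (d+1)) (α β : ℂ) :
    ∑ j, eval a (pderiv j (C α * (X p * X q) - C β * (X r * X m))) * w j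
      = α * (a p * w q + w p * a q) - β * (a r * w m + w r * a m) := by
  have hl : ∀ i, HasDerivAt (fun e : ℂ => a i + e * w i) (w i) 0 := fun i => by
    simpa using ((hasDerivAt_id (0:ℂ)).mul_const (w i)).const_add (a i)
  have h1 := eval_chain (C α * (X p * X q) - C β * (X r * X m)) (fun e i => a i + e * w i) w hl
  have h2 := (((hl p).fun_mul (hl q)).const_mul α).fun_sub (((hl r).fun_mul (hl m)).const_mul β)
  simp only [map_sub, map_mul, eval_C, eval_X] at h1
  have := h1.unique h2
  simp only [zero_mul, add_zero] at this
  simp only [map_sub]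
  rw [this]
  ring

/-- power point -/
def pw (d : ℕ) (t u v : ℂ) : Fin (d+1) → ℂ := fun i => t * (d.choose i) * (u ^ (d - (i:ℕ)) * v ^ (i:ℕ))

lemma T_det {n : ℕ} {s : ℂ} {w : Fin (n+3) → ℂ} (hw : w ∈ zTangentAt (Scone (n+2)) (pw (n+2) 1 1 s))
    (h0 : w 0 = 0) (h1 : w 1 = 0) : w = 0 := by
  have key : ∀ i : ℕ, ∀ hi : i < n + 3, w ⟨i, hi⟩ = 0 := by
    intro i
    induction i with
    | zero => intro _; exact h0
    | succ i ih =>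
      intro hi
      rcases Nat.eq_zero_or_pos i with rfl | hpos
      · exact h1
      have ihi := ih (by omega)
      have hc : ∀ j, j ≤ n + 2 → (((n+2).choose j : ℕ) : ℂ) ≠ 0 := fun j hj => by
        exact_mod_cast (Nat.choose_pos hj).ne'
      have hT := hw (C (1 / ((n+2).choose (i+1) : ℂ)) * (X 0 * X ⟨i+1, hi⟩)
        - C (1 / ((n+2).choose 1 * (n+2).choose i : ℂ)) * (X 1 * X ⟨i, by omega⟩)) ?_
      · rw [diff_XX, h0, h1, ihi] at hT
        have e0 : pw (n+2) 1 1 s 0 = 1 := by simp [pw]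
        rw [e0] at hT
        simp at hT
        rcases hT with hT | hT
        · exact absurd hT (by exact_mod_cast (Nat.choose_pos (show i + 1 ≤ n + 2 by omega)).ne')
        · exact hT
      · intro y hy
        obtain ⟨t, u, v, rfl⟩ := mem_Scone.1 hy
        have c1 := hc (i+1) (by omega)
        have c2 := hc i (by omega)
        have c3 := hc 1 (by omega)
        have v1 : ((1 : Fin (n+3)) : ℕ) = 1 := rfl
        have p1 : n + 2 - i = (n + 2 - (i+1)) + 1 := by omega
        simp only [map_sub, map_mul, eval_C, eval_X, v1, p1, Fin.val_zero, Nat.choose_zero_right]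
        have p2 : n + 2 - 1 = n + 1 := rfl
        rw [p2]
        field_simp
        simp
        right
        ring
  funext i
  exact key i i.2

lemma tv_surj {n : ℕ} (s x y : ℂ) : ∃ α β : ℂ, tv (n+2) 1 1 s α β 0 = x ∧ tv (n+2) 1 1 s α β 1 = y := by
  have hd : ((n : ℂ) + 2) ≠ 0 := by exact_mod_cast Nat.succ_ne_zero (n+1)
  refine ⟨x / (n+2), y / (n+2) - (n+1) * (x / (n+2)) * s, ?_, ?_⟩
  · simp [tv, tvn]
    field_simp
  · have v1 : ((1 : Fin (n+3)) : ℕ) = 1 := rfl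
    have p2 : n + 2 - 1 = n + 1 := rfl
    simp [tv, tvn, v1, p2]
    field_simp

lemma T_dim (n : ℕ) (s : ℂ) : zTangentDim (Scone (n+2)) (pw (n+2) 1 1 s) = 2 := by
  have hspan : Submodule.span ℂ (zTangentAt (Scone (n+2)) (pw (n+2) 1 1 s)) = Tsub (n+2) (pw (n+2) 1 1 s) :=
    Submodule.span_eq (Tsub (n+2) (pw (n+2) 1 1 s))
  unfold zTangentDim
  rw [hspan]
  let φ : Tsub (n+2) (pw (n+2) 1 1 s) →ₗ[ℂ] ℂ × ℂ :=
    { toFun := fun w => (w.1 0, w.1 1)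
      map_add' := fun a b => rfl
      map_smul' := fun a b => rfl }
  have hinj : Function.Injective φ := by
    rw [injective_iff_map_eq_zero]
    rintro ⟨w, hw⟩ h
    have h' := Prod.ext_iff.1 h
    exact Subtype.ext (T_det hw h'.1 h'.2)
  have hsurj : Function.Surjective φ := by
    rintro ⟨x, y⟩
    obtain ⟨α, β, h1, h2⟩ := tv_surj (n := n) s x y
    exact ⟨⟨tv (n+2) 1 1 s α β, tv_mem _ _ _ _ _ _⟩, Prod.ext h1 h2⟩
  rw [(LinearEquiv.ofBijective φ ⟨hinj, hsurj⟩).finrank_eq]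
  simp

/-- generating set of the dual cone -/
def Eset (d : ℕ) : Set (Fin (d+1) → ℂ) := {h | h ≠ 0 ∧ ∃ a ∈ Scone d, a ≠ 0 ∧ zTangentDim (Scone d) a = 2 ∧
      ∀ v ∈ zTangentAt (Scone d) a, apolarPair d h v = 0}

lemma mem_E_of_dbl {n : ℕ} {u v : ℂ} (hv : v ≠ 0) (b : Fin (n+1) → ℂ)
    (h0 : mulLin (n+1) u v (mulLin n u v b) ≠ 0) : mulLin (n+1) u v (mulLin n u v b) ∈ Eset (n+2) := by
  refine ⟨h0, pw (n+2) 1 1 (-u/v), mem_Scone.2 ⟨1, 1, _, rfl⟩, ?_, T_dim _ _, ?_⟩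
  · intro h
    have := congrFun h 0
    simp [pw] at this
  · intro w hw
    set s := -u/v with hs
    have hus : u + v * s = 0 := by rw [hs]; field_simp; ring
    obtain ⟨α, β, h1, h2⟩ := tv_surj (n := n) s (w 0) (w 1)
    have hwe : w = tv (n+2) 1 1 s α β := by
      rw [← sub_eq_zero]
      refine T_det (Submodule.sub_mem (Tsub (n+2) (pw (n+2) 1 1 s)) hw (tv_mem (n+2) 1 1 s α β)) ?_ ?_
      · simp [h1]
      · simp [h2]
    rw [hwe, apolarPair_tv]
    set h := mulLin (n+1) u v (mulLin n u v b) with hh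
    have d1 := fe_deriv (n+2) h 1 s α β
    have d2 : (fun e : ℂ => fe (n+2) h (1 + e * α) (s + e * β)) =
        fun e => (e * (u * α + v * β)) * ((e * (u * α + v * β)) * fe n b (1 + e * α) (s + e * β)) := by
      funext e
      rw [hh, fe_mulLin, fe_mulLin]
      have : u * (1 + e * α) + v * (s + e * β) = e * (u * α + v * β) := by linear_combination hus
      rw [this]
    rw [d2] at d1
    have d3 := (hasDerivAt_id (0:ℂ)).mul_const (u * α + v * β)
    have d4 := d3.fun_mul (d3.fun_mul (fe_deriv n b 1 s α β))
    have d5 := d1.unique d4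
    rw [d5]
    simp

lemma closure_sub_zClosure {d : ℕ} (S : Set (Fin d → ℂ)) : closure S ⊆ zClosure S := by
  intro x hx p hp
  have hc : IsClosed {y : Fin d → ℂ | eval y p = 0} :=
    isClosed_eq (MvPolynomial.continuous_eval p) continuous_const
  exact closure_minimal (fun y hy => hp y hy) hc hx

lemma zClosure_sub {d : ℕ} {S T : Set (Fin d → ℂ)} (h : S ⊆ zClosure T) : zClosure S ⊆ zClosure T := by
  intro x hx p hp
  exact hx p fun y hy => h hy p hp

lemma continuous_mulLinC {T : Type} [TopologicalSpace T] (n : ℕ) (u v : T → ℂ) (b : T → Fin (n+1) → ℂ)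
    (hu : Continuous u) (hv : Continuous v) (hb : Continuous b) :
    Continuous fun t => mulLin n (u t) (v t) (b t) := by
  refine continuous_pi fun i => ?_
  simp only [mulLin]
  refine (hu.mul ?_).add (hv.mul ?_)
  · refine Fin.lastCases ?_ (fun i => ?_) i
    · simpa using continuous_const
    · simp only [Fin.snoc_castSucc]
      exact (continuous_apply i).comp hb
  · refine Fin.cases ?_ (fun i => ?_) i
    · simpa using continuous_const
    · simp only [Fin.cons_succ]
      exact (continuous_apply i).comp hb

lemma ev_ne (c : ℂ) : ∀ᶠ e in nhdsWithin (0:ℂ) {0}ᶜ, c + e ≠ 0 := by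
  by_cases hc : c = 0
  · filter_upwards [self_mem_nhdsWithin] with e he
    simpa [hc] using he
  · have h1 : ContinuousAt (fun e : ℂ => c + e) 0 := by fun_prop
    exact (h1.eventually_ne (by simpa using hc)).filter_mono nhdsWithin_le_nhds

lemma dbl_mem_closure (n : ℕ) (u v : ℂ) (b : Fin (n+1) → ℂ) :
    mulLin (n+1) u v (mulLin n u v b) ∈ closure (Eset (n+2)) := by
  let γ : ℂ → Fin (n+3) → ℂ := fun e =>
    mulLin (n+1) u (v + e) (mulLin n u (v + e) (fun i => b i + e))
  have hγ : Continuous γ :=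
    continuous_mulLinC _ _ _ _ (by fun_prop) (by fun_prop)
      (continuous_mulLinC _ _ _ _ (by fun_prop) (by fun_prop) (by fun_prop))
  have h0 : γ 0 = mulLin (n+1) u v (mulLin n u v b) := by simp [γ]
  rw [← h0]
  refine mem_closure_of_tendsto (b := nhdsWithin (0:ℂ) {0}ᶜ) (hγ.continuousAt.tendsto.mono_left nhdsWithin_le_nhds) ?_
  filter_upwards [ev_ne v, ev_ne (b 0)] with e h1 h2
  refine mem_E_of_dbl h1 _ ?_
  intro h3
  have h4 := binForm_mulLin (n+1) u (v+e) (mulLin n u (v + e) (fun i => b i + e))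
  rw [h3, binForm_zero, binForm_mulLin] at h4
  have hl : linForm u (v + e) ≠ 0 := linForm_ne_zero (Or.inr h1)
  have h5 := ((mul_eq_zero.1 h4.symm).resolve_left hl)
  have h6 := binForm_eq_zero n ((mul_eq_zero.1 h5).resolve_left hl)
  exact h2 (congrFun h6 0)

lemma alg_sub (n : ℕ) (hd : Odd (n+3)) : algBoundary (n+3) (n+3) ⊆ zClosure (Eset (n+3)) := by
  apply zClosure_sub
  refine subset_trans ?_ (closure_sub_zClosure _)
  rintro _ ⟨a, ha, rfl⟩
  rw [topBoundary_eq n hd] at ha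
  by_cases h0 : a = 0
  · have := dbl_mem_closure (n+1) 0 0 0
    have e : (fun i => ((a i : ℝ) : ℂ)) = mulLin (n+1+1) 0 0 (mulLin (n+1) 0 0 0) := by
      funext i
      simp [h0, mulLin]
    simp only [e]
    exact this
  · obtain ⟨u, v, _, b, hb⟩ := dbl_of_closure ha.1 ha.2 h0
    have := dbl_mem_closure (n+1) u v (fun i => (b i : ℂ))
    convert this using 1
    funext i
    rw [hb]
    have e1 := mulLin_map Complex.ofRealHom (n+1+1) u v (mulLin (n+1) u v b) i
    have e2 : (fun j => Complex.ofRealHom (mulLin (n+1) u v b j)) =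
        mulLin (n+1) (u : ℂ) (v : ℂ) (fun i => (b i : ℂ)) :=
      funext fun j => mulLin_map Complex.ofRealHom (n+1) u v b j
    rw [e2] at e1
    exact e1

lemma eval_aeval_gen {τ : Type} {d : ℕ} (G : Fin d → MvPolynomial τ ℂ) (p : MvPolynomial (Fin d) ℂ) (θ : τ → ℂ) :
    eval θ (aeval G p) = eval (fun i => eval θ (G i)) p := by
  induction p using MvPolynomial.induction_on with
  | C a => simp [algebraMap_eq]
  | add p q hp hq => simp only [map_add, hp, hq]
  | mul_X p i hp => simp only [map_mul, hp, aeval_X, eval_X]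

/-- doubled parameter vector -/
def dc {K : Type} (n : ℕ) (u : K) (A : Fin n → K) : Fin (n+2) → K := Fin.cons u (Fin.cons u A)

lemma dc_map {K L : Type} (f : K → L) (n : ℕ) (u : K) (A : Fin n → K) :
    (fun i => f (dc n u A i)) = dc n (f u) (fun i => f (A i)) := by
  funext i
  unfold dc
  refine Fin.cases rfl (fun i => ?_) i
  refine Fin.cases rfl (fun i => ?_) i
  rfl

lemma dbl_prodC {K : Type} [CommSemiring K] (n : ℕ) (u v : K) (A B : Fin n → K) :
    prodC (n+2) (dc n u A) (dc n v B) = mulLin (n+1) u v (mulLin n u v (prodC n A B)) := rfl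

lemma dbl_eval_zero (n : ℕ) (p : MvPolynomial (Fin (n+3)) ℂ)
    (hp : ∀ (t u v : ℝ) (A B : Fin n → ℝ),
      eval (fun i => ((t * prodC (n+2) (dc n u A) (dc n v B) i : ℝ) : ℂ)) p = 0)
    (t u v : ℂ) (A B : Fin n → ℂ) :
    eval (fun i => t * prodC (n+2) (dc n u A) (dc n v B) i) p = 0 := by
  let R := MvPolynomial (Fin 3 ⊕ (Fin n ⊕ Fin n)) ℂ
  let G : Fin (n+3) → R := fun i => X (Sum.inl 0) *
    prodC (n+2) (dc n (X (Sum.inl 1)) (fun i => X (Sum.inr (Sum.inl i))))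
      (dc n (X (Sum.inl 2)) (fun i => X (Sum.inr (Sum.inr i)))) i
  have hG : ∀ θ i, eval θ (G i) = θ (Sum.inl 0) *
    prodC (n+2) (dc n (θ (Sum.inl 1)) (fun i => θ (Sum.inr (Sum.inl i))))
      (dc n (θ (Sum.inl 2)) (fun i => θ (Sum.inr (Sum.inr i)))) i := by
    intro θ i
    simp only [G, map_mul, eval_X, prodC_map (eval θ), dc_map (eval θ)]
  have hP : aeval G p = 0 := by
    apply MvPolynomial.funext_set (fun _ => Set.range Complex.ofReal)
    · intro i
      exact Set.infinite_range_of_injective Complex.ofReal_injective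
    · intro θ hθ
      rw [eval_aeval_gen, map_zero]
      have hθ' : ∀ i, ∃ x : ℝ, (x : ℂ) = θ i := fun i => hθ i (Set.mem_univ i)
      choose ρ hρ using hθ'
      obtain rfl : θ = fun i => (ρ i : ℂ) := funext fun i => (hρ i).symm
      have := hp (ρ (Sum.inl 0)) (ρ (Sum.inl 1)) (ρ (Sum.inl 2)) (fun i => ρ (Sum.inr (Sum.inl i)))
        (fun i => ρ (Sum.inr (Sum.inr i)))
      rw [← this]
      congr 2
      funext i
      rw [hG, Complex.ofReal_mul]
      congr 1
      have e := prodC_map Complex.ofRealHom (n+2) (dc n (ρ (Sum.inl 1)) (fun i => ρ (Sum.inr (Sum.inl i))))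
        (dc n (ρ (Sum.inl 2)) (fun i => ρ (Sum.inr (Sum.inr i)))) i
      simp only [dc_map Complex.ofRealHom] at e
      exact e.symm
  have h1 := eval_aeval_gen G p (Sum.elim ![t, u, v] (Sum.elim A B))
  rw [hP, map_zero] at h1
  simp only [hG] at h1
  simpa using h1.symm

lemma E_sub (n : ℕ) (hd : Odd (n+3)) : Eset (n+3) ⊆ algBoundary (n+3) (n+3) := by
  rintro h ⟨_, a, ha, ha0, _, hT⟩ p hp
  obtain ⟨u, v, _, b, rfl⟩ := dbl_of_E (n := n+1) ha ha0 hT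
  obtain ⟨t, A, B, hb⟩ := factor_complex (n+1) b
  have hb2 : b = t • prodC (n+1) A B := by
    apply binForm_inj
    rw [hb, binForm_smul, binForm_prodC]
  have key := dbl_eval_zero (n+1) p (fun t u v A B => hp _ ⟨t • prodC (n+3) (dc (n+1) u A) (dc (n+1) v B), ?_, rfl⟩)
    t u v A B
  · have e : mulLin (n+1+1) u v (mulLin (n+1) u v b) = fun i => t * prodC (n+1+2) (dc (n+1) u A) (dc (n+1) v B) i := by
      change _ = t • prodC (n+1+2) (dc (n+1) u A) (dc (n+1) v B)
      apply binForm_inj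
      rw [dbl_prodC, hb2]
      rw [binForm_smul]
      simp only [binForm_mulLin, binForm_smul]
      ring
    rw [e]
    exact key
  · rw [topBoundary_eq n hd]
    exact ⟨prod_mem_closure _ _ _ _, dbl_notMem (n+1) t u v A B⟩

lemma main_big (n : ℕ) (hd : Odd (n+3)) :
    algBoundary (n+3) (n+3) = dualConeOf (n+3) (crlCone (n+3) 1 fun _ => n+3) 2 := by
  change _ = zClosure (Eset (n+3))
  apply Set.Subset.antisymm (alg_sub n hd)
  exact zClosure_sub (E_sub n hd)

lemma main_one : algBoundary 1 1 = dualConeOf 1 (crlCone 1 1 fun _ => 1) 2 := by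
  change _ = zClosure (Eset 1)
  have h1 : topBoundary 1 1 = ∅ := by
    have hc : closure (Rdr 1 1) = Set.univ := by
      rw [Rdr_eq odd_one, Set.eq_univ_iff_forall]
      intro a
      have := prod_mem_closure 1 1 (fun _ => a 0) (fun _ => a 1)
      convert this using 1
      apply binForm_inj
      rw [binForm_smul, binForm_prodC]
      simp [binForm, linForm, Fin.sum_univ_two]
    unfold topBoundary
    rw [hc]
    simp
  have h2 : Eset 1 = ∅ := by
    rw [Set.eq_empty_iff_forall_notMem]
    rintro h ⟨h0, a, _, _, _, hT⟩
    have hS : ∀ y, y ∈ Scone 1 := fun y =>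
      ⟨1, fun _ => y 0, fun _ => y 1, by simp [binForm, linForm, Fin.sum_univ_two]⟩
    have hall : ∀ v, v ∈ zTangentAt (Scone 1) a := by
      intro v p hp
      have : p = 0 := MvPolynomial.funext fun y => by rw [hp y (hS y), map_zero]
      simp [this]
    apply h0
    have e0 := hT _ (hall ![1, 0])
    have e1 := hT _ (hall ![0, 1])
    rw [apolarPair_eq] at e0 e1
    simp [Fin.sum_univ_two] at e0 e1
    funext i
    fin_cases i
    · exact e0
    · exact e1
  unfold algBoundary
  rw [h1, h2, Set.image_empty]

theorem main_thm (d : ℕ) (hd : Odd d) :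
    algBoundary d d = dualConeOf d (crlCone d 1 fun _ => d) 2 ∧ Rdr d d = HypSet d := by
  refine ⟨?_, Rdr_eq hd⟩
  match d, hd with
  | 0, hd => exact absurd hd (by decide)
  | 1, _ => exact main_one
  | 2, hd => exact absurd hd (by decide)
  | n+3, hd => exact main_big n hd

/-- for odd degree `d = 2k−1`, the algebraic boundary of the region of forms
of maximal typical rank `d` is the dual variety of the rational normal curve
`Δ_{(d)}` (the discriminant hypersurface), and `R_{d,d}` consists exactly of the forms with
`d` distinct real roots. -/
theorem odd_maximal_rank_boundary (k : ℕ) (hk : 1 ≤ k) :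
    algBoundary (2*k - 1) (2*k - 1)
        = dualConeOf (2*k - 1) (crlCone (2*k - 1) 1 fun _ => 2*k - 1) 2 ∧
      Rdr (2*k - 1) (2*k - 1)
        = {a | ∃ t : ℝ, t ≠ 0 ∧ ∃ A B : Fin (2*k - 1) → ℝ,
            (∀ i, A i ≠ 0 ∨ B i ≠ 0) ∧
            (∀ i j, i ≠ j → A i * B j ≠ A j * B i) ∧
            binForm (2*k - 1) a = C t * ∏ i, linForm (A i) (B i)} := by
  exact main_thm (2*k - 1) ⟨k - 1, by omega⟩
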